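/- arXiv:2512.25001 — 2 statements merged into one kernel-verified Lean document; each statement's English description precedes it below -/
import Mathlib

section
/- Let G_n be a sequence of simple connected graphs such that the local limit of the minimum spanning tree MST(G_n) exists. If β_n ≫ (|E(G_n)|/|V(G_n)|)·log|V(G_n)|, then the local limits of WST^{β_n}(G_n) and MST(G_n) agree. -/
open MeasureTheory Filter Finset

noncomputable section

set_option linter.unusedSectionVars false

namespace WSTPaper

variable {V : Type} [Fintype V] [DecidableEq V]

open scoped Classical in
/-- The edge sets of spanning trees of `G`. -/
def spanningTrees (G : SimpleGraph V) : Finset (Finset (Sym2 V)) :=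
  Finset.univ.filter
    (fun T => ↑T ⊆ G.edgeSet ∧ (SimpleGraph.fromEdgeSet (↑T : Set (Sym2 V))).IsTree)

/-- Weight of a spanning tree: product of its edge conductances. -/
def treeWeight (c : Sym2 V → ℝ) (T : Finset (Sym2 V)) : ℝ := ∏ e ∈ T, c e

/-- Partition function of the weighted spanning tree measure. -/
def partZ (G : SimpleGraph V) (c : Sym2 V → ℝ) : ℝ := ∑ T ∈ spanningTrees G, treeWeight c T

/-- The ball of radius `r` around `x` in `G`, as a set of vertices. -/
def ballSet (G : SimpleGraph V) (x : V) (r : ℕ) : Set V :=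
  {y | G.Reachable x y ∧ G.dist x y ≤ r}

lemma mem_ballSet_self (G : SimpleGraph V) (x : V) (r : ℕ) : x ∈ ballSet G x r :=
  ⟨SimpleGraph.Reachable.refl x, by simp [SimpleGraph.dist_self]⟩

/-- The `r`-ball of `G` around `x` is rooted-isomorphic to the rooted graph `(H, w)`. -/
def BallIso (G : SimpleGraph V) (x : V) (r : ℕ) {W : Type} (H : SimpleGraph W) (w : W) : Prop :=
  ∃ φ : SimpleGraph.induce (ballSet G x r) G ≃g H, φ ⟨x, mem_ballSet_self G x r⟩ = w

open scoped Classical in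
/-- `P(B_{WST(c)}(X, r) ≅ (H, w))`, where `X` is a uniform random vertex of `G`. -/
def wstBallProb (G : SimpleGraph V) (c : Sym2 V → ℝ) (r : ℕ)
    {W : Type} (H : SimpleGraph W) (w : W) : ℝ :=
  (Fintype.card V : ℝ)⁻¹ *
    ∑ x : V, (∑ T ∈ spanningTrees G,
      if BallIso (SimpleGraph.fromEdgeSet (↑T : Set (Sym2 V))) x r H w then treeWeight c T else 0)
      / partZ G c

/-- Product of i.i.d. Uniform[0,1] label measures. -/
def labelMeasure (ι : Type) [Fintype ι] : Measure (ι → ℝ) :=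
  Measure.pi fun _ => (volume.restrict (Set.Icc (0:ℝ) 1))

/-- `P(B_{WST^β(G)}(X, r) ≅ (H, w))`: annealed ball probability for the weighted spanning tree
with random conductances `c_β(e) = exp(-β U_e)`, `U_e` i.i.d. uniform on `[0,1]`. -/
def wstBetaBallProb (G : SimpleGraph V) (β : ℝ) (r : ℕ)
    {W : Type} (H : SimpleGraph W) (w : W) : ℝ :=
  ∫ u : Sym2 V → ℝ,
    wstBallProb G (fun e => Real.exp (-β * u e)) r H w ∂(labelMeasure (Sym2 V))

/-- `T` is a minimum spanning tree of `G` for the labels `u`. -/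
def IsMST (G : SimpleGraph V) (u : Sym2 V → ℝ) (T : Finset (Sym2 V)) : Prop :=
  T ∈ spanningTrees G ∧ ∀ T' ∈ spanningTrees G, ∑ e ∈ T, u e ≤ ∑ e ∈ T', u e

/-- `P(B_{MST(G)}(X, r) ≅ (H, w))`, where `X` is a uniform random vertex and `MST(G)` is the
(a.s. unique) minimum spanning tree for i.i.d. Uniform[0,1] edge labels. -/
def mstBallProb (G : SimpleGraph V) (r : ℕ) {W : Type} (H : SimpleGraph W) (w : W) : ℝ :=
  (Fintype.card V : ℝ)⁻¹ * ∑ x : V,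
    ((labelMeasure (Sym2 V))
      {u | ∃ T, IsMST G u T ∧ (∀ T', IsMST G u T' → T' = T) ∧
        BallIso (SimpleGraph.fromEdgeSet (↑T : Set (Sym2 V))) x r H w}).toReal

/-- The graph on `V` whose edges are the non-loops of `T`. -/
abbrev edgeGraph (T : Finset (Sym2 V)) : SimpleGraph V :=
  SimpleGraph.fromEdgeSet (↑T : Set (Sym2 V))

section SpanningTrees

variable {G : SimpleGraph V}

lemma mem_spanningTrees {T : Finset (Sym2 V)} :
    T ∈ spanningTrees G ↔ (↑T : Set (Sym2 V)) ⊆ G.edgeSet ∧ (edgeGraph T).IsTree := by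
  simp [spanningTrees]

lemma edgeSet_edgeGraph {T : Finset (Sym2 V)} (h : (↑T : Set (Sym2 V)) ⊆ G.edgeSet) :
    (edgeGraph T).edgeSet = ↑T := by
  rw [SimpleGraph.edgeSet_fromEdgeSet, sdiff_eq_left]
  exact (Set.disjoint_left.2 fun e he hd => G.not_isDiag_of_mem_edgeSet (h he) hd)

lemma isTree_iff_card {T : Finset (Sym2 V)} (h : (↑T : Set (Sym2 V)) ⊆ G.edgeSet) :
    (edgeGraph T).IsTree ↔ (edgeGraph T).Connected ∧ T.card + 1 = Fintype.card V := by
  rw [SimpleGraph.isTree_iff_connected_and_card, edgeSet_edgeGraph h, Nat.card_eq_fintype_card]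
  simp

lemma card_of_mem_spanningTrees {T : Finset (Sym2 V)} (h : T ∈ spanningTrees G) :
    T.card + 1 = Fintype.card V := by
  rw [mem_spanningTrees] at h
  exact ((isTree_iff_card h.1).1 h.2).2

lemma spanningTrees_nonempty (hG : G.Connected) : (spanningTrees G).Nonempty := by
  classical
  obtain ⟨T, hle, hT⟩ := hG.exists_isTree_le
  refine ⟨T.edgeFinset, mem_spanningTrees.2 ⟨?_, ?_⟩⟩
  · simpa using hle
  · simpa [edgeGraph] using hT

/-- Deleting `f` from a spanning tree leaves at most two components. -/
lemma reachable_erase_or {T : Finset (Sym2 V)} (hT : (edgeGraph T).Connected) (x y v : V) :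
    (edgeGraph (T.erase s(x, y))).Reachable x v ∨ (edgeGraph (T.erase s(x, y))).Reachable y v := by
  obtain ⟨p⟩ := hT.preconnected x v
  by_contra! hv
  obtain ⟨d, -, hd, hd'⟩ := p.exists_boundary_dart
    {v | (edgeGraph (T.erase s(x, y))).Reachable x v ∨
      (edgeGraph (T.erase s(x, y))).Reachable y v} (Or.inl (SimpleGraph.Reachable.refl x))
      (by simpa using hv)
  have hadj := d.adj
  rw [SimpleGraph.fromEdgeSet_adj] at hadj
  by_cases h : s(d.fst, d.snd) = s(x, y)
  · apply hd'
    rcases Sym2.eq_iff.1 h with h | h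
    · exact Or.inr (h.2 ▸ SimpleGraph.Reachable.refl _)
    · exact Or.inl (h.2 ▸ SimpleGraph.Reachable.refl _)
  · have h2 : (edgeGraph (T.erase s(x, y))).Adj d.fst d.snd := by
      rw [SimpleGraph.fromEdgeSet_adj]
      exact ⟨mem_coe.2 (mem_erase.2 ⟨h, hadj.1⟩), hadj.2⟩
    apply hd'
    rcases hd with hd | hd
    · exact Or.inl (hd.trans h2.reachable)
    · exact Or.inr (hd.trans h2.reachable)

lemma insert_erase_mem_spanningTrees {T : Finset (Sym2 V)} (hT : T ∈ spanningTrees G)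
    {f : Sym2 V} (hf : f ∈ T) {a b : V} (hab : G.Adj a b)
    (hr : ¬ (edgeGraph (T.erase f)).Reachable a b) :
    insert s(a, b) (T.erase f) ∈ spanningTrees G := by
  rw [mem_spanningTrees] at hT
  have hsub : (↑(insert s(a, b) (T.erase f)) : Set (Sym2 V)) ⊆ G.edgeSet := by
    intro e he
    simp only [coe_insert, coe_erase, Set.mem_insert_iff, Set.mem_sdiff] at he
    rcases he with rfl | he
    · exact hab
    · exact hT.1 he.1
  have hT2 := (isTree_iff_card hT.1).1 hT.2
  refine mem_spanningTrees.2 ⟨hsub, (isTree_iff_card hsub).2 ⟨?_, ?_⟩⟩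
  · have hle : edgeGraph (T.erase f) ≤ edgeGraph (insert s(a, b) (T.erase f)) :=
      SimpleGraph.fromEdgeSet_mono (by simp)
    have hadj : (edgeGraph (insert s(a, b) (T.erase f))).Reachable a b :=
      SimpleGraph.Adj.reachable (by
        rw [SimpleGraph.fromEdgeSet_adj]; exact ⟨by simp, hab.ne⟩)
    induction f with
    | h x y =>
    have key := reachable_erase_or hT2.1 x y
    have hxy : (edgeGraph (insert s(a, b) (T.erase s(x, y)))).Reachable x y := by
      rcases key a with ha | ha <;> rcases key b with hb | hb
      · exact absurd (ha.symm.trans hb) hr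
      · exact ((ha.mono hle).trans hadj).trans (hb.mono hle).symm
      · exact ((hb.mono hle).trans hadj.symm).trans (ha.mono hle).symm
      · exact absurd (ha.symm.trans hb) hr
    have hx : ∀ v, (edgeGraph (insert s(a, b) (T.erase s(x, y)))).Reachable x v := fun v => by
      rcases key v with h | h
      · exact h.mono hle
      · exact hxy.trans (h.mono hle)
    have : Nonempty V := ⟨x⟩
    exact ⟨fun u v => (hx u).symm.trans (hx v)⟩
  · have : s(a, b) ∉ T.erase f := fun h =>
      hr (SimpleGraph.Adj.reachable (by
        rw [SimpleGraph.fromEdgeSet_adj]; exact ⟨mem_coe.2 h, hab.ne⟩))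
    rw [card_insert_of_notMem this, card_erase_add_one hf, hT2.2]

/-- The endpoints of an edge `f` of a spanning tree are separated by deleting `f`. -/
lemma not_reachable_erase {T : Finset (Sym2 V)} (hT : T ∈ spanningTrees G) {x y : V}
    (hf : s(x, y) ∈ T) : ¬ (edgeGraph (T.erase s(x, y))).Reachable x y := by
  rw [mem_spanningTrees] at hT
  have h1 := SimpleGraph.isAcyclic_iff_forall_isBridge.1 hT.2.isAcyclic
    (e := s(x, y)) (by rw [edgeSet_edgeGraph hT.1]; exact hf)
  rw [SimpleGraph.isBridge_iff] at h1
  refine fun h => h1 (h.mono ?_)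
  intro a b hab
  simp only [SimpleGraph.fromEdgeSet_adj, coe_erase, Set.mem_sdiff, mem_coe,
    Set.mem_singleton_iff, SimpleGraph.deleteEdges_adj] at hab ⊢
  tauto

/-- The endpoints of `e` are joined by edges of `G` other than `e` that satisfy `p`. -/
def Linked (G : SimpleGraph V) (e : Sym2 V) (p : Sym2 V → Prop) : Prop :=
  ∀ x y, e = s(x, y) →
    (SimpleGraph.fromEdgeSet {f | f ∈ G.edgeSet ∧ f ≠ e ∧ p f}).Reachable x y

lemma Linked.exists_swap {e : Sym2 V} {p : Sym2 V → Prop} (h : Linked G e p)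
    {T : Finset (Sym2 V)} (hT : T ∈ spanningTrees G) (he : e ∈ T) :
    ∃ f ∈ G.edgeSet, p f ∧ f ∉ T.erase e ∧ insert f (T.erase e) ∈ spanningTrees G := by
  induction e with
  | h x y =>
  obtain ⟨w⟩ := h x y rfl
  obtain ⟨d, -, hd, hd'⟩ := w.exists_boundary_dart
    {v | (edgeGraph (T.erase s(x, y))).Reachable x v} (SimpleGraph.Reachable.refl x)
    (not_reachable_erase hT he)
  have hadj := d.adj
  simp only [SimpleGraph.fromEdgeSet_adj, Set.mem_ofPred_eq] at hadj
  have hr : ¬ (edgeGraph (T.erase s(x, y))).Reachable d.fst d.snd := fun h => hd' (hd.trans h)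
  refine ⟨s(d.fst, d.snd), hadj.1.1, hadj.1.2.2, fun hm => hr ?_, ?_⟩
  · exact SimpleGraph.Adj.reachable (by
        rw [SimpleGraph.fromEdgeSet_adj]; exact ⟨mem_coe.2 hm, hadj.2⟩)
  · exact insert_erase_mem_spanningTrees hT he hadj.1.1 hr

/-- An edge whose endpoints are not joined by strictly smaller labels lies in the unique MST. -/
lemma mem_of_not_linked {u : Sym2 V → ℝ} {M : Finset (Sym2 V)} (hM : IsMST G u M)
    (huniq : ∀ T', IsMST G u T' → T' = M) {e : Sym2 V} (he : e ∈ G.edgeSet)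
    (hl : ¬ Linked G e (fun f => u f < u e)) : e ∈ M := by
  by_contra heM
  apply hl
  rintro x y rfl
  have hMt := mem_spanningTrees.1 hM.1
  obtain ⟨p, hp⟩ := (hMt.2.connected.preconnected x y).exists_isPath
  have hpM : ∀ f ∈ p.edges, f ∈ M := fun f hf => by
    have := p.edges_subset_edgeSet hf
    rwa [edgeSet_edgeGraph hMt.1] at this
  suffices h : ∀ f ∈ p.edges,
      f ∈ (SimpleGraph.fromEdgeSet {f | f ∈ G.edgeSet ∧ f ≠ s(x, y) ∧ u f < u s(x, y)}).edgeSet from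
    (p.transfer _ h).reachable
  intro f hf
  have hfM := hpM f hf
  rw [SimpleGraph.edgeSet_fromEdgeSet]
  refine ⟨⟨hMt.1 hfM, fun h => heM (h ▸ hfM), ?_⟩, G.not_isDiag_of_mem_edgeSet (hMt.1 hfM)⟩
  by_contra! hle
  have hr : ¬ (edgeGraph (M.erase f)).Reachable x y := by
    intro hr
    obtain ⟨q, hq⟩ := hr.exists_isPath
    have hsub : edgeGraph (M.erase f) ≤ edgeGraph M :=
      SimpleGraph.fromEdgeSet_mono (by simp)
    have hpq := (hMt.2.isAcyclic.subsingleton_path x y).elim ⟨p, hp⟩ ⟨q.mapLe hsub, hq.mapLe hsub⟩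
    have hpq' : p = q.mapLe hsub := congrArg Subtype.val hpq
    rw [hpq', SimpleGraph.Walk.edges_mapLe_eq_edges] at hf
    have := q.edges_subset_edgeSet hf
    rw [SimpleGraph.edgeSet_fromEdgeSet] at this
    simp at this
  have hnew := insert_erase_mem_spanningTrees hM.1 hfM he hr
  have hnot : s(x, y) ∉ M.erase f := fun h => heM (mem_of_mem_erase h)
  have hsum : ∑ g ∈ insert s(x, y) (M.erase f), u g ≤ ∑ g ∈ M, u g := by
    rw [sum_insert hnot, ← add_sum_erase M u hfM]
    linarith
  have := huniq _ ⟨hnew, fun T' hT' => hsum.trans (hM.2 T' hT')⟩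
  exact heM (this ▸ mem_insert_self _ _)

end SpanningTrees

section Balls

variable {A B : SimpleGraph V}

lemma dist_le_succ_iff (hA : A.Connected) {x y : V} {k : ℕ} :
    A.dist x y ≤ k + 1 ↔ A.dist x y ≤ k ∨ ∃ z, A.dist x z ≤ k ∧ A.Adj z y := by
  constructor
  · intro h
    by_cases hk : A.dist x y ≤ k
    · exact Or.inl hk
    right
    obtain ⟨p, hp⟩ := hA.exists_walk_length_eq_dist y x
    rw [SimpleGraph.dist_comm] at hp
    cases p with
    | nil => simp at hk
    | @cons _ z _ hadj q =>
      refine ⟨z, ?_, hadj.symm⟩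
      rw [SimpleGraph.Walk.length_cons] at hp
      have := SimpleGraph.dist_le q
      rw [SimpleGraph.dist_comm] at this
      omega
  · rintro (h | ⟨z, hz, hzy⟩)
    · omega
    · have h1 := hA.dist_triangle (u := x) (v := z) (w := y)
      have h2 := SimpleGraph.dist_eq_one_iff_adj.2 hzy
      omega

/-- Two graphs with the same edges at all vertices at distance less than `r` from `x` have the same
distances up to `r`. -/
lemma dist_le_iff_of_adj_iff (hA : A.Connected) (hB : B.Connected) {x : V} {r : ℕ}
    (h : ∀ a, A.dist x a < r → ∀ v, A.Adj a v ↔ B.Adj a v) {k : ℕ} (hk : k ≤ r) (y : V) :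
    A.dist x y ≤ k ↔ B.dist x y ≤ k := by
  induction k generalizing y with
  | zero => rw [Nat.le_zero, Nat.le_zero, hA.dist_eq_zero_iff, hB.dist_eq_zero_iff]
  | succ k ih =>
    rw [dist_le_succ_iff hA, dist_le_succ_iff hB, ih (by omega)]
    refine or_congr Iff.rfl (exists_congr fun z => ?_)
    rw [← ih (by omega) z]
    exact and_congr_right fun hz => h z (by omega) y

lemma BallIso.of_adj_iff (hA : A.IsTree) (hB : B.IsTree) {x : V} {r : ℕ}
    (h : ∀ a, A.dist x a < r → ∀ v, A.Adj a v ↔ B.Adj a v)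
    {W : Type} {H : SimpleGraph W} {w : W} (hiso : BallIso A x r H w) : BallIso B x r H w := by
  have hd := fun k (hk : k ≤ r) y =>
    dist_le_iff_of_adj_iff hA.connected hB.connected h hk y
  have hball : ballSet B x r = ballSet A x r := by
    ext y
    exact and_congr (iff_of_true (hB.connected.preconnected x y) (hA.connected.preconnected x y))
      (hd r le_rfl y).symm
  have hadj : ∀ y z, A.dist x y ≤ r → A.dist x z ≤ r → (B.Adj y z ↔ A.Adj y z) := by
    intro y z hy hz
    by_cases hy' : A.dist x y < r
    · exact (h y hy' z).symm
    by_cases hz' : A.dist x z < r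
    · rw [A.adj_comm, B.adj_comm]
      exact (h z hz' y).symm
    have hAe : A.dist x y = A.dist x z := by omega
    have hBe : B.dist x y = B.dist x z := by
      have h1 := hd r le_rfl y
      have h2 := hd r le_rfl z
      have h3 := hd (r - 1) (by omega) y
      have h4 := hd (r - 1) (by omega) z
      omega
    refine iff_of_false (fun hyz => ?_) (fun hyz => ?_)
    · exact hB.isAcyclic.dist_ne_of_adj hyz (hB.connected.preconnected x y) hBe
    · exact hA.isAcyclic.dist_ne_of_adj hyz (hA.connected.preconnected x y) hAe
  obtain ⟨φ, hφ⟩ := hiso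
  let ψ : SimpleGraph.induce (ballSet B x r) B ≃g SimpleGraph.induce (ballSet A x r) A :=
    { toEquiv := Equiv.setCongr hball
      map_rel_iff' := by
        intro a b
        have ha : a.1 ∈ ballSet A x r := hball ▸ a.2
        have hb : b.1 ∈ ballSet A x r := hball ▸ b.2
        exact (hadj a.1 b.1 ha.2 hb.2).symm }
  exact ⟨ψ.trans φ, hφ⟩

lemma BallIso.card_eq (hA : A.Connected) {x : V} {r m : ℕ} {H : SimpleGraph (Fin m)} {w : Fin m}
    (h : BallIso A x r H w) : #{y | A.dist x y ≤ r} = m := by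
  obtain ⟨φ, -⟩ := h
  have h1 := Nat.card_congr φ.toEquiv
  rw [Nat.card_eq_fintype_card (α := Fin m), Fintype.card_fin] at h1
  rw [← h1, ← Set.ncard_coe_finset, ← Nat.card_coe_set_eq]
  congr 2
  ext y
  simp [ballSet, hA.preconnected x y]

/-- In a connected graph, at most `m ^ k` vertices at distance `k` from `a` have a ball of radius
`k + 1` with at most `m` vertices. -/
lemma card_dist_eq_small_ball_le (hA : A.Connected) (a : V) (m k : ℕ) :
    #{x | A.dist x a = k ∧ #{y | A.dist x y ≤ k + 1} ≤ m} ≤ m ^ k := by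
  induction k with
  | zero =>
    rw [pow_zero, card_le_one]
    intro x hx y hy
    simp only [mem_filter, mem_univ, true_and, hA.dist_eq_zero_iff] at hx hy
    rw [hx.1, hy.1]
  | succ k ih =>
    set N : Finset V := {x | A.dist x a = k ∧ #{y | A.dist x y ≤ k + 1} ≤ m} with hN
    have hsub : ({x | A.dist x a = k + 1 ∧ #{y | A.dist x y ≤ k + 1 + 1} ≤ m} : Finset V) ⊆
        N.biUnion fun z => {x | A.dist z x ≤ 1} := by
      intro x hx
      simp only [mem_filter, mem_univ, true_and] at hx
      have h1 : A.dist a x ≤ k + 1 := by rw [SimpleGraph.dist_comm]; omega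
      rw [dist_le_succ_iff hA, SimpleGraph.dist_comm] at h1
      rcases h1 with h1 | ⟨z, hz, hzx⟩
      · omega
      have hd := SimpleGraph.dist_eq_one_iff_adj.2 hzx
      have hd' : A.dist x z = 1 := by rw [SimpleGraph.dist_comm]; exact hd
      have htri := hA.dist_triangle (u := x) (v := z) (w := a)
      rw [A.dist_comm (u := z) (v := a)] at htri
      simp only [mem_biUnion, hN, mem_filter, mem_univ, true_and]
      refine ⟨z, ⟨?_, (card_le_card ?_).trans hx.2⟩, hd.le⟩
      · rw [SimpleGraph.dist_comm]; omega
      · intro y hy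
        simp only [mem_filter, mem_univ, true_and] at hy ⊢
        have := hA.dist_triangle (u := x) (v := z) (w := y)
        omega
    refine (card_le_card hsub).trans (card_biUnion_le.trans ?_)
    rw [pow_succ]
    refine (sum_le_card_nsmul N _ m fun z hz => ?_).trans (by
      rw [smul_eq_mul]; exact Nat.mul_le_mul_right m ih)
    simp only [hN, mem_filter, mem_univ, true_and] at hz
    refine (card_le_card fun y hy => ?_).trans hz.2
    simp only [mem_filter, mem_univ, true_and] at hy ⊢
    omega

open scoped Classical in
lemma card_ballIso_not_ballIso_le (hA : A.IsTree) (hB : B.IsTree) {S : Finset V}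
    (hS : ∀ a ∉ S, ∀ v, A.Adj a v ↔ B.Adj a v) (r : ℕ) {m : ℕ} (H : SimpleGraph (Fin m))
    (w : Fin m) :
    #{x | BallIso A x r H w ∧ ¬ BallIso B x r H w} ≤ #S * ∑ k ∈ range r, m ^ k := by
  have hsub : ({x | BallIso A x r H w ∧ ¬ BallIso B x r H w} : Finset V) ⊆
      S.biUnion fun a => (range r).biUnion fun k =>
        {x | A.dist x a = k ∧ #{y | A.dist x y ≤ k + 1} ≤ m} := by
    intro x hx
    simp only [mem_filter, mem_univ, true_and] at hx
    obtain ⟨a, hd, haS⟩ : ∃ a, A.dist x a < r ∧ a ∈ S := by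
      by_contra! hcon
      exact hx.2 (hx.1.of_adj_iff hA hB fun a ha => hS a (hcon a ha))
    simp only [mem_biUnion, mem_filter, mem_univ, true_and, mem_range]
    refine ⟨a, haS, _, hd, rfl, ?_⟩
    rw [← hx.1.card_eq hA.connected]
    refine card_le_card fun y hy => ?_
    simp only [mem_filter, mem_univ, true_and] at hy ⊢
    omega
  refine (card_le_card hsub).trans (card_biUnion_le.trans ?_)
  rw [← smul_eq_mul]
  refine sum_le_card_nsmul S _ _ fun a _ => card_biUnion_le.trans ?_
  exact sum_le_sum fun k _ => card_dist_eq_small_ball_le hA.connected a m k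

open scoped Classical in
/-- Two spanning trees have the same `r`-balls except around few vertices. -/
lemma card_ballIso_ne_le {G : SimpleGraph V} {T M : Finset (Sym2 V)} (hT : T ∈ spanningTrees G)
    (hM : M ∈ spanningTrees G) (r : ℕ) {m : ℕ} (H : SimpleGraph (Fin m)) (w : Fin m) :
    #{x | ¬ (BallIso (edgeGraph T) x r H w ↔ BallIso (edgeGraph M) x r H w)} ≤
      8 * (∑ k ∈ range r, m ^ k) * #(T \ M) := by
  have hTt := (mem_spanningTrees.1 hT).2
  have hMt := (mem_spanningTrees.1 hM).2
  set S : Finset V := (T \ M ∪ M \ T).biUnion Sym2.toFinset with hSdef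
  have hS : ∀ a ∉ S, ∀ v, (edgeGraph T).Adj a v ↔ (edgeGraph M).Adj a v := by
    intro a ha v
    simp only [hSdef, mem_biUnion, mem_union, Sym2.mem_toFinset, not_exists,
      not_and] at ha
    have h1 : s(a, v) ∈ T → s(a, v) ∈ M := fun h => by_contra fun h' =>
      ha s(a, v) (Or.inl (Finset.mem_sdiff.2 ⟨h, h'⟩)) (Sym2.mem_mk_left a v)
    have h2 : s(a, v) ∈ M → s(a, v) ∈ T := fun h => by_contra fun h' =>
      ha s(a, v) (Or.inr (Finset.mem_sdiff.2 ⟨h, h'⟩)) (Sym2.mem_mk_left a v)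
    simp only [SimpleGraph.fromEdgeSet_adj, mem_coe]
    exact and_congr_left fun _ => ⟨h1, h2⟩
  have hcard : #(M \ T) = #(T \ M) := by
    have h1 := card_of_mem_spanningTrees hT
    have h2 := card_of_mem_spanningTrees hM
    have h3 := card_sdiff_add_card_inter M T
    have h4 := card_sdiff_add_card_inter T M
    rw [inter_comm] at h4
    omega
  have hScard : #S ≤ 4 * #(T \ M) := by
    refine card_biUnion_le.trans ((sum_le_card_nsmul _ _ 2 fun e _ => ?_).trans ?_)
    · rw [Sym2.card_toFinset]; split_ifs <;> omega
    · have := card_union_le (T \ M) (M \ T)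
      rw [smul_eq_mul]; omega
  have h1 := card_ballIso_not_ballIso_le hTt hMt hS r H w
  have h2 := card_ballIso_not_ballIso_le hMt hTt (fun a ha v => (hS a ha v).symm) r H w
  calc _ ≤ #(({x | BallIso (edgeGraph T) x r H w ∧ ¬ BallIso (edgeGraph M) x r H w} : Finset V) ∪
        ({x | BallIso (edgeGraph M) x r H w ∧ ¬ BallIso (edgeGraph T) x r H w} : Finset V)) := by
        refine card_le_card fun x hx => ?_
        simp only [mem_filter, mem_univ, true_and, mem_union] at hx ⊢
        tauto
    _ ≤ #S * (∑ k ∈ range r, m ^ k) + #S * ∑ k ∈ range r, m ^ k :=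
        (card_union_le _ _).trans (add_le_add h1 h2)
    _ = 2 * (∑ k ∈ range r, m ^ k) * #S := by ring
    _ ≤ 2 * (∑ k ∈ range r, m ^ k) * (4 * #(T \ M)) := Nat.mul_le_mul_left _ hScard
    _ = _ := by ring

end Balls

section Labels

instance (ι : Type) [Fintype ι] : IsProbabilityMeasure (labelMeasure ι) := by
  have : IsProbabilityMeasure (volume.restrict (Set.Icc (0 : ℝ) 1)) := ⟨by simp⟩
  unfold labelMeasure
  infer_instance

/-- A label event whose slices in one coordinate have diameter at most `δ` has probability at
most `δ`. -/
lemma labelMeasure_le_of_slice {ι : Type} [Fintype ι] [DecidableEq ι] {A : Set (ι → ℝ)}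
    (hA : MeasurableSet A) (i : ι) {δ : ℝ}
    (h : ∀ u s t, Function.update u i s ∈ A → Function.update u i t ∈ A → t - s ≤ δ) :
    labelMeasure ι A ≤ ENNReal.ofReal δ := by
  have : IsProbabilityMeasure (volume.restrict (Set.Icc (0 : ℝ) 1)) := ⟨by simp⟩
  have hf : Measurable (A.indicator (1 : (ι → ℝ) → ENNReal)) := measurable_one.indicator hA
  rw [← lintegral_indicator_one hA]
  have key : ∫⁻ u, A.indicator 1 u ∂labelMeasure ι ≤
      ∫⁻ _, ENNReal.ofReal δ ∂labelMeasure ι := by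
    refine lintegral_le_of_lmarginal_le {i} hf measurable_const fun u => ?_
    rw [lmarginal_singleton, lmarginal_singleton, lintegral_const, measure_univ, mul_one]
    have hslice : MeasurableSet (Function.update u i ⁻¹' A) :=
      (measurable_update u) hA
    calc ∫⁻ t, A.indicator 1 (Function.update u i t) ∂volume.restrict (Set.Icc (0 : ℝ) 1)
        = ∫⁻ t, (Function.update u i ⁻¹' A).indicator 1 t ∂volume.restrict (Set.Icc (0 : ℝ) 1) :=
          rfl
      _ = volume.restrict (Set.Icc (0 : ℝ) 1) (Function.update u i ⁻¹' A) :=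
          lintegral_indicator_one hslice
      _ ≤ volume (Function.update u i ⁻¹' A) := Measure.restrict_apply_le _ _
      _ ≤ Metric.ediam (Function.update u i ⁻¹' A) := Real.volume_le_diam _
      _ ≤ ENNReal.ofReal δ := by
          refine Metric.ediam_le fun s hs t ht => ?_
          rw [edist_dist, Real.dist_eq]
          exact ENNReal.ofReal_le_ofReal (abs_le.2 ⟨by linarith [h u s t hs ht], h u t s ht hs⟩)
  simpa using key

variable {G : SimpleGraph V}

lemma measurableSet_of_finite_pred {α κ : Type} [MeasurableSpace α] [Finite κ]
    {p : α → κ → Prop} (hp : ∀ k, MeasurableSet {a | p a k}) (Q : (κ → Prop) → Prop) :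
    MeasurableSet {a | Q (p a)} := by
  have hm : Measurable p := measurable_pi_iff.2 fun k => measurableSet_setOfPred.1 (hp k)
  exact hm (MeasurableSet.of_discrete (s := {q | Q q}))

lemma Linked.mono {e : Sym2 V} {p q : Sym2 V → Prop} (h : Linked G e p)
    (hpq : ∀ f, f ≠ e → p f → q f) : Linked G e q := fun x y hxy =>
  (h x y hxy).mono (SimpleGraph.fromEdgeSet_mono fun f hf => ⟨hf.1, hf.2.1, hpq f hf.2.1 hf.2.2⟩)

/-- The labels for which `e` exceeds the bottleneck between its endpoints by less than `δ`. -/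
def closeLabels (G : SimpleGraph V) (e : Sym2 V) (δ : ℝ) : Set (Sym2 V → ℝ) :=
  {u | Linked G e (fun f => u f < u e) ∧ ¬ Linked G e (fun f => u f ≤ u e - δ)}

lemma measurableSet_closeLabels (e : Sym2 V) (δ : ℝ) : MeasurableSet (closeLabels G e δ) := by
  refine MeasurableSet.inter ?_ (MeasurableSet.compl ?_)
  · exact measurableSet_of_finite_pred (p := fun (u : Sym2 V → ℝ) f => u f < u e)
      (fun f => measurableSet_lt (measurable_pi_apply f) (measurable_pi_apply e)) (Linked G e)
  · exact measurableSet_of_finite_pred (p := fun (u : Sym2 V → ℝ) f => u f ≤ u e - δ)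
      (fun f => measurableSet_le (measurable_pi_apply f) (Measurable.sub_const (f := fun u : Sym2 V → ℝ => u e) (measurable_pi_apply e) δ))
      (Linked G e)

lemma labelMeasure_closeLabels_le (e : Sym2 V) (δ : ℝ) :
    labelMeasure (Sym2 V) (closeLabels G e δ) ≤ ENNReal.ofReal δ := by
  refine labelMeasure_le_of_slice (measurableSet_closeLabels e δ) e fun u s t hs ht => ?_
  by_contra! hst
  refine ht.2 (hs.1.mono fun f hf hlt => ?_)
  simp only [Function.update_self, Function.update_of_ne hf] at hlt ⊢
  linarith

lemma labelMeasure_sum_eq {T T' : Finset (Sym2 V)} {e : Sym2 V} (he : e ∈ T) (he' : e ∉ T') :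
    labelMeasure (Sym2 V) {u | ∑ f ∈ T, u f = ∑ f ∈ T', u f} = 0 := by
  rw [← nonpos_iff_eq_zero, ← ENNReal.ofReal_zero]
  refine labelMeasure_le_of_slice (measurableSet_eq_fun
    (Finset.measurable_sum _ fun f _ => measurable_pi_apply f)
    (Finset.measurable_sum _ fun f _ => measurable_pi_apply f)) e fun u s t hs ht => ?_
  have hT : ∀ s, ∑ f ∈ T, Function.update u e s f = s + ∑ f ∈ T.erase e, u f := fun s => by
    rw [← add_sum_erase T _ he, Function.update_self]
    exact congrArg _ (sum_congr rfl fun f hf => Function.update_of_ne (ne_of_mem_erase hf) _ _)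
  have hT' : ∀ s, ∑ f ∈ T', Function.update u e s f = ∑ f ∈ T', u f := fun s =>
    sum_congr rfl fun f hf => Function.update_of_ne (ne_of_mem_of_not_mem hf he') _ _
  simp only [Set.mem_ofPred_eq, hT, hT'] at hs ht
  linarith

/-- The minimum spanning tree is almost surely unique. -/
lemma ae_exists_unique_isMST (hG : G.Connected) :
    ∀ᵐ u ∂labelMeasure (Sym2 V), ∃ M, IsMST G u M ∧ ∀ T', IsMST G u T' → T' = M := by
  have h : ∀ᵐ u ∂labelMeasure (Sym2 V), ∀ T ∈ spanningTrees G, ∀ T' ∈ spanningTrees G, T ≠ T' →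
      ∑ f ∈ T, u f ≠ ∑ f ∈ T', u f := by
    refine (eventually_all_finset _).2 fun T hT => (eventually_all_finset _).2 fun T' hT' => ?_
    rw [eventually_imp_distrib_left]
    intro hne
    obtain ⟨e, he, he'⟩ : ∃ e ∈ T, e ∉ T' := by
      by_contra! hsub
      refine hne (eq_of_subset_of_card_le hsub ?_)
      have h1 := card_of_mem_spanningTrees hT
      have h2 := card_of_mem_spanningTrees hT'
      omega
    rw [ae_iff]
    simpa using labelMeasure_sum_eq he he'
  filter_upwards [h] with u hu
  obtain ⟨M, hM, hmin⟩ := exists_min_image (spanningTrees G) (fun T => ∑ f ∈ T, u f)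
    (spanningTrees_nonempty hG)
  refine ⟨M, ⟨hM, hmin⟩, fun T' hT' => ?_⟩
  by_contra hne
  exact hu T' hT'.1 M hM hne (le_antisymm (hT'.2 M hM) (hmin T' hT'.1))

/-- The labels for which the MST is unique and its ball around `x` is `(H, w)`. -/
def mstBallEvent (G : SimpleGraph V) (x : V) (r : ℕ) {W : Type} (H : SimpleGraph W) (w : W) :
    Set (Sym2 V → ℝ) :=
  {u | ∃ T, IsMST G u T ∧ (∀ T', IsMST G u T' → T' = T) ∧
    BallIso (SimpleGraph.fromEdgeSet (↑T : Set (Sym2 V))) x r H w}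

lemma measurableSet_mstBallEvent (x : V) (r : ℕ) {W : Type} (H : SimpleGraph W) (w : W) :
    MeasurableSet (mstBallEvent G x r H w) := by
  refine measurableSet_of_finite_pred (κ := Finset (Sym2 V)) (p := fun u T => IsMST G u T)
    (fun T => ?_) (fun q => ∃ T, q T ∧ (∀ T', q T' → T' = T) ∧
      BallIso (SimpleGraph.fromEdgeSet (↑T : Set (Sym2 V))) x r H w)
  exact measurableSet_of_finite_pred (κ := Finset (Sym2 V))
    (p := fun (u : Sym2 V → ℝ) T' => ∑ f ∈ T, u f ≤ ∑ f ∈ T', u f)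
    (fun T' => measurableSet_le (Finset.measurable_sum _ fun f _ => measurable_pi_apply f)
      (Finset.measurable_sum _ fun f _ => measurable_pi_apply f))
    (fun q => T ∈ spanningTrees G ∧ ∀ T' ∈ spanningTrees G, q T')

lemma mstBallProb_eq_integral (r : ℕ) {W : Type} (H : SimpleGraph W) (w : W) :
    mstBallProb G r H w = ∫ u, (Fintype.card V : ℝ)⁻¹ *
      ∑ x : V, (mstBallEvent G x r H w).indicator 1 u ∂labelMeasure (Sym2 V) := by
  rw [integral_const_mul, integral_finsetSum]
  · unfold mstBallProb
    congr 1
    refine sum_congr rfl fun x _ => ?_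
    rw [integral_indicator_one (measurableSet_mstBallEvent x r H w)]
    rfl
  · intro x _
    exact (integrable_const (1 : ℝ)).indicator (measurableSet_mstBallEvent x r H w)

lemma integrable_mst (r : ℕ) {W : Type} (H : SimpleGraph W) (w : W) :
    Integrable (fun u => (Fintype.card V : ℝ)⁻¹ *
      ∑ x : V, (mstBallEvent G x r H w).indicator (1 : (Sym2 V → ℝ) → ℝ) u)
      (labelMeasure (Sym2 V)) :=
  (integrable_finsetSum _ fun x _ =>
    (integrable_const (1 : ℝ)).indicator (measurableSet_mstBallEvent x r H w)).const_mul _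

end Labels

section Comparison

variable {G : SimpleGraph V}

lemma treeWeight_exp_pos (β : ℝ) (u : Sym2 V → ℝ) (T : Finset (Sym2 V)) :
    0 < treeWeight (fun e => Real.exp (-β * u e)) T :=
  prod_pos fun _ _ => Real.exp_pos _

lemma partZ_exp_pos (hG : G.Connected) (β : ℝ) (u : Sym2 V → ℝ) :
    0 < partZ G (fun e => Real.exp (-β * u e)) :=
  sum_pos (fun T _ => treeWeight_exp_pos β u T) (spanningTrees_nonempty hG)

/-- An edge whose label exceeds the bottleneck between its endpoints by `δ` is unlikely to be used
by the weighted spanning tree. -/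
lemma sum_treeWeight_le_of_linked [DecidableRel G.Adj] {β δ : ℝ} (hβ : 0 ≤ β) {u : Sym2 V → ℝ}
    {e : Sym2 V} (h : Linked G e (fun f => u f ≤ u e - δ)) :
    ∑ T ∈ spanningTrees G with e ∈ T, treeWeight (fun e => Real.exp (-β * u e)) T ≤
      #G.edgeFinset * Real.exp (-β * δ) * partZ G (fun e => Real.exp (-β * u e)) := by
  set c : Sym2 V → ℝ := fun e => Real.exp (-β * u e) with hc
  let P : Finset (Sym2 V) → Sym2 V → Prop := fun T f =>
    u f ≤ u e - δ ∧ f ∉ T.erase e ∧ insert f (T.erase e) ∈ spanningTrees G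
  classical
  have hw : ∀ T, 0 < treeWeight c T := treeWeight_exp_pos β u
  have hweight : ∀ T f, e ∈ T → P T f →
      treeWeight c T ≤ Real.exp (-β * δ) * treeWeight c (insert f (T.erase e)) := by
    intro T f he hP
    have h1 : treeWeight c T = c e * treeWeight c (T.erase e) := (mul_prod_erase T c he).symm
    have h2 : treeWeight c (insert f (T.erase e)) = c f * treeWeight c (T.erase e) :=
      prod_insert hP.2.1
    rw [h1, h2, ← mul_assoc]
    refine mul_le_mul_of_nonneg_right ?_ (hw _).le
    rw [hc, ← Real.exp_add, Real.exp_le_exp]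
    nlinarith [mul_le_mul_of_nonneg_left hP.1 hβ]
  calc ∑ T ∈ spanningTrees G with e ∈ T, treeWeight c T
      ≤ ∑ T ∈ spanningTrees G with e ∈ T, ∑ f ∈ G.edgeFinset,
          if P T f then Real.exp (-β * δ) * treeWeight c (insert f (T.erase e)) else 0 := by
        refine sum_le_sum fun T hT => ?_
        rw [mem_filter] at hT
        obtain ⟨f, hf, hp⟩ := h.exists_swap hT.1 hT.2
        refine (hweight T f hT.2 hp).trans ?_
        refine le_trans (by rw [if_pos hp]) (single_le_sum (f := fun f =>
          if P T f then Real.exp (-β * δ) * treeWeight c (insert f (T.erase e)) else 0)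
          (fun g _ => ?_) (SimpleGraph.mem_edgeFinset.2 hf))
        split_ifs
        · exact mul_nonneg (Real.exp_pos _).le (hw _).le
        · exact le_rfl
    _ = ∑ f ∈ G.edgeFinset, ∑ T ∈ spanningTrees G with e ∈ T,
          if P T f then Real.exp (-β * δ) * treeWeight c (insert f (T.erase e)) else 0 := sum_comm
    _ ≤ ∑ f ∈ G.edgeFinset, Real.exp (-β * δ) * partZ G c := by
        refine sum_le_sum fun f _ => ?_
        rw [← sum_filter, ← mul_sum]
        refine mul_le_mul_of_nonneg_left ?_ (Real.exp_pos _).le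
        rw [← sum_image (f := treeWeight c) (g := fun T => insert f (T.erase e)) (s :=
          {T ∈ {T ∈ spanningTrees G | e ∈ T} | P T f})]
        · refine sum_le_sum_of_subset_of_nonneg (fun T' hT' => ?_) fun T' _ _ => (hw T').le
          obtain ⟨T, hT, rfl⟩ := mem_image.1 hT'
          exact (mem_filter.1 hT).2.2.2
        · intro T hT T' hT' heq
          simp only [coe_filter, mem_filter, Set.mem_ofPred_eq] at hT hT'
          have h1 := congrArg (fun S => insert e (S.erase f)) heq
          simp only [erase_insert hT.2.2.1, erase_insert hT'.2.2.1, insert_erase hT.1.2,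
            insert_erase hT'.1.2] at h1
          exact h1
    _ = _ := by rw [sum_const, nsmul_eq_mul]; ring

open scoped Classical in
/-- For fixed labels, the average number of edges at which the weighted spanning tree and the
minimum spanning tree differ. -/
lemma sum_treeWeight_mul_card_sdiff_le [DecidableRel G.Adj] {β δ : ℝ} (hβ : 0 ≤ β)
    {u : Sym2 V → ℝ} {M : Finset (Sym2 V)} (hG : G.Connected) (hM : IsMST G u M)
    (huniq : ∀ T', IsMST G u T' → T' = M) :
    ∑ T ∈ spanningTrees G, treeWeight (fun e => Real.exp (-β * u e)) T * #(T \ M) ≤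
      (∑ e ∈ G.edgeFinset, ((closeLabels G e δ).indicator 1 u +
        #G.edgeFinset * Real.exp (-β * δ))) * partZ G (fun e => Real.exp (-β * u e)) := by
  set c : Sym2 V → ℝ := fun e => Real.exp (-β * u e) with hc
  have hw : ∀ T, 0 < treeWeight c T := treeWeight_exp_pos β u
  have hZ : 0 < partZ G c := partZ_exp_pos hG β u
  calc ∑ T ∈ spanningTrees G, treeWeight c T * #(T \ M)
      = ∑ T ∈ spanningTrees G, ∑ e ∈ G.edgeFinset, if e ∈ T ∧ e ∉ M then treeWeight c T else 0 := by
        refine sum_congr rfl fun T hT => ?_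
        rw [← sum_filter, sum_const, nsmul_eq_mul, mul_comm]
        congr 3
        ext e
        simp only [Finset.mem_sdiff, mem_filter, SimpleGraph.mem_edgeFinset]
        exact ⟨fun h => ⟨(mem_spanningTrees.1 hT).1 h.1, h⟩, fun h => h.2⟩
    _ = ∑ e ∈ G.edgeFinset, ∑ T ∈ spanningTrees G, if e ∈ T ∧ e ∉ M then treeWeight c T else 0 :=
        sum_comm
    _ ≤ ∑ e ∈ G.edgeFinset, ((closeLabels G e δ).indicator 1 u +
        #G.edgeFinset * Real.exp (-β * δ)) * partZ G c := by
        refine sum_le_sum fun e he => ?_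
        have hE : 0 ≤ #G.edgeFinset * Real.exp (-β * δ) := by positivity
        by_cases heM : e ∈ M
        · simp only [heM, not_true, and_false, if_false, sum_const_zero]
          exact mul_nonneg (add_nonneg (Set.indicator_nonneg (by simp) _) hE) hZ.le
        simp only [heM, not_false_iff, and_true]
        rw [← sum_filter]
        by_cases hfar : Linked G e (fun f => u f ≤ u e - δ)
        · refine (sum_treeWeight_le_of_linked hβ hfar).trans ?_
          refine mul_le_mul_of_nonneg_right ?_ hZ.le
          exact le_add_of_nonneg_left (Set.indicator_nonneg (by simp) _)
        · have hmem : u ∈ closeLabels G e δ := by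
            refine ⟨?_, hfar⟩
            by_contra hl
            exact heM (mem_of_not_linked hM huniq (SimpleGraph.mem_edgeFinset.1 he) hl)
          rw [Set.indicator_of_mem hmem, Pi.one_apply]
          calc ∑ T ∈ spanningTrees G with e ∈ T, treeWeight c T ≤ partZ G c :=
                sum_le_sum_of_subset_of_nonneg (filter_subset _ _) fun T _ _ => (hw T).le
            _ ≤ _ := le_mul_of_one_le_left hZ.le (by linarith)
    _ = _ := by rw [sum_mul]

open scoped Classical in
lemma abs_wstBallProb_sub_le [DecidableRel G.Adj] {β δ : ℝ} (hβ : 0 ≤ β)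
    {u : Sym2 V → ℝ} {M : Finset (Sym2 V)} (hG : G.Connected) (hM : IsMST G u M)
    (huniq : ∀ T', IsMST G u T' → T' = M) (r : ℕ) {m : ℕ} (H : SimpleGraph (Fin m)) (w : Fin m) :
    |wstBallProb G (fun e => Real.exp (-β * u e)) r H w - (Fintype.card V : ℝ)⁻¹ *
      ∑ x : V, (mstBallEvent G x r H w).indicator 1 u| ≤
      (Fintype.card V : ℝ)⁻¹ * ((8 * ∑ k ∈ range r, (m : ℝ) ^ k) *
        ∑ e ∈ G.edgeFinset, ((closeLabels G e δ).indicator 1 u +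
          #G.edgeFinset * Real.exp (-β * δ))) := by
  set c : Sym2 V → ℝ := fun e => Real.exp (-β * u e) with hc
  have hw : ∀ T, 0 < treeWeight c T := treeWeight_exp_pos β u
  have hZ : 0 < partZ G c := partZ_exp_pos hG β u
  have hind : ∀ x, (mstBallEvent G x r H w).indicator (1 : (Sym2 V → ℝ) → ℝ) u =
      if BallIso (edgeGraph M) x r H w then 1 else 0 := by
    intro x
    rw [Set.indicator_apply, Pi.one_apply]
    refine if_congr ⟨?_, fun h => ⟨M, hM, huniq, h⟩⟩ rfl rfl
    rintro ⟨T, hT, -, hb⟩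
    exact huniq T hT ▸ hb
  have hdiff : wstBallProb G c r H w - (Fintype.card V : ℝ)⁻¹ *
      ∑ x : V, (mstBallEvent G x r H w).indicator 1 u =
      (Fintype.card V : ℝ)⁻¹ * ((∑ T ∈ spanningTrees G, treeWeight c T *
        ∑ x : V, ((if BallIso (edgeGraph T) x r H w then (1 : ℝ) else 0) -
          if BallIso (edgeGraph M) x r H w then 1 else 0)) / partZ G c) := by
    unfold wstBallProb
    rw [← mul_sub, ← sum_sub_distrib]
    congr 1
    simp only [mul_sum]
    rw [sum_comm, sum_div]
    refine sum_congr rfl fun x _ => ?_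
    rw [hind, eq_div_iff hZ.ne', sub_mul, div_mul_cancel₀ _ hZ.ne']
    simp only [mul_sub, sum_sub_distrib, mul_ite, mul_one, mul_zero]
    congr 1
    split_ifs
    · rw [one_mul]; rfl
    · simp
  rw [hdiff, abs_mul, abs_of_nonneg (by positivity : (0 : ℝ) ≤ (Fintype.card V : ℝ)⁻¹)]
  refine mul_le_mul_of_nonneg_left ?_ (by positivity)
  rw [abs_div, abs_of_pos hZ, div_le_iff₀ hZ]
  calc |∑ T ∈ spanningTrees G, treeWeight c T *
        ∑ x : V, ((if BallIso (edgeGraph T) x r H w then (1 : ℝ) else 0) -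
          if BallIso (edgeGraph M) x r H w then 1 else 0)|
      ≤ ∑ T ∈ spanningTrees G, treeWeight c T *
          ((8 * ∑ k ∈ range r, (m : ℝ) ^ k) * #(T \ M)) := by
        refine (abs_sum_le_sum_abs _ _).trans (sum_le_sum fun T hT => ?_)
        rw [abs_mul, abs_of_pos (hw T)]
        refine mul_le_mul_of_nonneg_left ?_ (hw T).le
        have hcard := card_ballIso_ne_le hT hM.1 r H w
        calc _ ≤ ∑ x : V, |(if BallIso (edgeGraph T) x r H w then (1 : ℝ) else 0) -
                if BallIso (edgeGraph M) x r H w then 1 else 0| := abs_sum_le_sum_abs _ _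
          _ = ∑ x : V, if ¬ (BallIso (edgeGraph T) x r H w ↔ BallIso (edgeGraph M) x r H w)
                then (1 : ℝ) else 0 := by
              refine sum_congr rfl fun x _ => ?_
              by_cases h1 : BallIso (edgeGraph T) x r H w <;>
                by_cases h2 : BallIso (edgeGraph M) x r H w <;> simp [h1, h2]
          _ = (#{x | ¬ (BallIso (edgeGraph T) x r H w ↔ BallIso (edgeGraph M) x r H w)} : ℕ) := by
              rw [sum_boole]
          _ ≤ _ := by exact_mod_cast hcard
    _ = (8 * ∑ k ∈ range r, (m : ℝ) ^ k) * ∑ T ∈ spanningTrees G, treeWeight c T * #(T \ M) := by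
        rw [mul_sum (spanningTrees G)]
        exact sum_congr rfl fun T _ => mul_left_comm _ _ _
    _ ≤ _ := by
        rw [mul_assoc (8 * ∑ k ∈ range r, (m : ℝ) ^ k)]
        exact mul_le_mul_of_nonneg_left (sum_treeWeight_mul_card_sdiff_le hβ hG hM huniq)
          (by positivity : (0 : ℝ) ≤ 8 * ∑ k ∈ range r, (m : ℝ) ^ k)

lemma integrable_wst (hG : G.Connected) (β : ℝ) (r : ℕ) {W : Type} (H : SimpleGraph W) (w : W) :
    Integrable (fun u : Sym2 V → ℝ => wstBallProb G (fun e => Real.exp (-β * u e)) r H w)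
      (labelMeasure (Sym2 V)) := by
  classical
  have hcw : ∀ T : Finset (Sym2 V), Continuous fun u : Sym2 V → ℝ =>
      treeWeight (fun e => Real.exp (-β * u e)) T := fun T => by
    unfold treeWeight
    fun_prop
  have hcont : Continuous fun u : Sym2 V → ℝ =>
      wstBallProb G (fun e => Real.exp (-β * u e)) r H w := by
    unfold wstBallProb
    refine continuous_const.mul (continuous_finsetSum _ fun x _ => Continuous.div ?_ ?_
      fun u => (partZ_exp_pos hG β u).ne')
    · refine continuous_finsetSum _ fun T _ => ?_
      split_ifs
      · exact hcw T
      · exact continuous_const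
    · exact continuous_finsetSum _ fun T _ => hcw T
  refine Integrable.of_bound hcont.aestronglyMeasurable
    ((Fintype.card V : ℝ)⁻¹ * ∑ _x : V, 1) (ae_of_all _ fun u => ?_)
  have hZ := partZ_exp_pos hG β u
  have hw := treeWeight_exp_pos β u
  unfold wstBallProb
  rw [Real.norm_eq_abs, abs_of_nonneg]
  · refine mul_le_mul_of_nonneg_left (sum_le_sum fun x _ => ?_) (by positivity)
    rw [div_le_one hZ]
    refine sum_le_sum fun T _ => ?_
    split_ifs
    · exact le_rfl
    · exact (hw T).le
  · refine mul_nonneg (by positivity) (sum_nonneg fun x _ => div_nonneg (sum_nonneg fun T _ => ?_)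
      hZ.le)
    split_ifs
    · exact (hw T).le
    · exact le_rfl

/-- Quantitative comparison of the ball probabilities of `WST^β` and the MST. -/
lemma abs_wstBetaBallProb_sub_mstBallProb_le [DecidableRel G.Adj] (hG : G.Connected) {β δ : ℝ}
    (hβ : 0 ≤ β) (hδ : 0 ≤ δ) (r : ℕ) {m : ℕ} (H : SimpleGraph (Fin m)) (w : Fin m) :
    |wstBetaBallProb G β r H w - mstBallProb G r H w| ≤
      (Fintype.card V : ℝ)⁻¹ * ((8 * ∑ k ∈ range r, (m : ℝ) ^ k) *
        (#G.edgeFinset * (δ + #G.edgeFinset * Real.exp (-β * δ)))) := by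
  have hone : ∀ e, Integrable ((closeLabels G e δ).indicator (1 : (Sym2 V → ℝ) → ℝ))
      (labelMeasure (Sym2 V)) := fun e =>
    (integrable_const (1 : ℝ)).indicator (measurableSet_closeLabels e δ)
  have hint : ∀ e ∈ G.edgeFinset, Integrable (fun u : Sym2 V → ℝ =>
      (closeLabels G e δ).indicator (1 : (Sym2 V → ℝ) → ℝ) u +
        #G.edgeFinset * Real.exp (-β * δ)) (labelMeasure (Sym2 V)) := fun e _ =>
    (hone e).add (integrable_const _)
  rw [mstBallProb_eq_integral, wstBetaBallProb,
    ← integral_sub (integrable_wst hG β r H w) (integrable_mst r H w)]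
  refine (abs_integral_le_integral_abs).trans ?_
  refine (integral_mono_ae (g := fun u => (Fintype.card V : ℝ)⁻¹ *
      ((8 * ∑ k ∈ range r, (m : ℝ) ^ k) * ∑ e ∈ G.edgeFinset,
        ((closeLabels G e δ).indicator 1 u + #G.edgeFinset * Real.exp (-β * δ))))
    ((integrable_wst hG β r H w).sub (integrable_mst r H w)).abs
    (((integrable_finsetSum _ hint).const_mul _).const_mul _)
    ((ae_exists_unique_isMST hG).mono fun u hu => ?_)).trans ?_
  · obtain ⟨M, hM, huniq⟩ := hu
    exact abs_wstBallProb_sub_le hβ hG hM huniq r H w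
  · rw [integral_const_mul, integral_const_mul, integral_finsetSum _ hint]
    refine mul_le_mul_of_nonneg_left (mul_le_mul_of_nonneg_left ?_ (by positivity)) (by positivity)
    refine (sum_le_card_nsmul G.edgeFinset _ (δ + #G.edgeFinset * Real.exp (-β * δ))
      fun e _ => ?_).trans_eq (nsmul_eq_mul _ _)
    rw [integral_add (hone e) (integrable_const _), integral_indicator_one (measurableSet_closeLabels e δ), integral_const,
      probReal_univ, one_smul]
    refine add_le_add_left ?_ _
    exact ENNReal.toReal_le_of_le_ofReal hδ (labelMeasure_closeLabels_le e δ)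

end Comparison

/-- With `δ = ε n / E`, the error bound is small once `β` is a large multiple of `(E / n) log n`. -/
lemma error_bound_le {n E β ε t : ℝ} (hn : 2 ≤ n) (hE : 1 ≤ E) (hEn : E ≤ n ^ 2) (hε : 0 < ε)
    (ht : 0 ≤ t) (hβ : (3 + t) / ε ≤ β / (E / n * Real.log n)) :
    n⁻¹ * (E * (ε * n / E + E * Real.exp (-β * (ε * n / E)))) ≤
      ε + Real.exp (-(t * Real.log 2)) := by
  have hn0 : 0 < n := by linarith
  have hE0 : 0 < E := by linarith
  have hlog : 0 < Real.log n := Real.log_pos (by linarith)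
  have hlog2 : Real.log 2 ≤ Real.log n := Real.log_le_log (by norm_num) hn
  have hβδ : (3 + t) * Real.log n ≤ β * (ε * n / E) := by
    rw [div_le_div_iff₀ hε (by positivity)] at hβ
    calc (3 + t) * Real.log n = (3 + t) * (E / n * Real.log n) * (n / E) := by
          field_simp
      _ ≤ β * ε * (n / E) := mul_le_mul_of_nonneg_right hβ (by positivity)
      _ = _ := by ring
  have hexp : Real.exp (-β * (ε * n / E)) ≤ (n ^ 3)⁻¹ * Real.exp (-(t * Real.log 2)) := by
    have h3 : (n ^ 3)⁻¹ = Real.exp (-(3 * Real.log n)) := by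
      rw [Real.exp_neg, mul_comm, Real.exp_mul, Real.exp_log hn0]
      norm_cast
    rw [h3, ← Real.exp_add, Real.exp_le_exp]
    nlinarith
  have hmain : n⁻¹ * (E * (ε * n / E + E * Real.exp (-β * (ε * n / E)))) =
      ε + n⁻¹ * E ^ 2 * Real.exp (-β * (ε * n / E)) := by
    field_simp
  rw [hmain]
  gcongr
  calc n⁻¹ * E ^ 2 * Real.exp (-β * (ε * n / E))
      ≤ n⁻¹ * (n ^ 2) ^ 2 * ((n ^ 3)⁻¹ * Real.exp (-(t * Real.log 2))) := by gcongr
    _ = Real.exp (-(t * Real.log 2)) := by field_simp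

/-- Let `Gₙ` be a sequence of simple connected graphs such that the local
limit of `MST(Gₙ)` exists (with ball-probability limits `L`).  If
`βₙ ≫ (|E(Gₙ)|/|V(Gₙ)|)·log |V(Gₙ)|`, then the local limits of `WST^{βₙ}(Gₙ)` and `MST(Gₙ)`
agree. -/
theorem local_limit_wst_beta_eq_mst
    (V : ℕ → Type) [∀ n, Fintype (V n)] [∀ n, DecidableEq (V n)]
    (G : ∀ n, SimpleGraph (V n)) [∀ n, DecidableRel (G n).Adj]
    (β : ℕ → ℝ)
    (hconn : ∀ n, (G n).Connected)
    (hβ0 : ∀ n, 0 ≤ β n)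
    -- βₙ ≫ (|E(Gₙ)|/|V(Gₙ)|)·log|V(Gₙ)|
    (hβ : Tendsto (fun n => β n /
        ((((G n).edgeFinset.card : ℝ) / (Fintype.card (V n) : ℝ)) *
          Real.log (Fintype.card (V n) : ℝ))) atTop atTop)
    -- the local limit of MST(Gₙ) exists, with ball-probability limits L
    (L : ∀ m : ℕ, SimpleGraph (Fin m) → Fin m → ℕ → ℝ)
    (hMST : ∀ (m : ℕ) (H : SimpleGraph (Fin m)) (w : Fin m) (r : ℕ),
      Tendsto (fun n => mstBallProb (G n) r H w) atTop (nhds (L m H w r))) :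
    ∀ (m : ℕ) (H : SimpleGraph (Fin m)) (w : Fin m) (r : ℕ),
      Tendsto (fun n => wstBetaBallProb (G n) (β n) r H w) atTop (nhds (L m H w r)) := by
  intro m H w r
  set K : ℝ := 8 * ∑ k ∈ range r, (m : ℝ) ^ k with hK
  have hK0 : 0 ≤ K := by positivity
  suffices h : Tendsto (fun n => wstBetaBallProb (G n) (β n) r H w - mstBallProb (G n) r H w)
      atTop (nhds 0) by
    simpa using h.add (hMST m H w r)
  rw [Metric.tendsto_nhds]
  intro η hη
  set ε : ℝ := η / (2 * (K + 1)) with hε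
  have hε0 : 0 < ε := by positivity
  obtain ⟨t, ht0, ht⟩ : ∃ t : ℝ, 0 ≤ t ∧ Real.exp (-(t * Real.log 2)) ≤ ε := by
    have h1 : Tendsto (fun t : ℝ => Real.exp (-(t * Real.log 2))) atTop (nhds 0) :=
      Real.tendsto_exp_neg_atTop_nhds_zero.comp
        (tendsto_id.atTop_mul_const (Real.log_pos one_lt_two))
    obtain ⟨t, h, ht⟩ := ((h1.eventually_le_const hε0).and (eventually_ge_atTop 0)).exists
    exact ⟨t, ht, h⟩
  filter_upwards [hβ.eventually_ge_atTop ((3 + t) / ε)] with n hn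
  set N : ℝ := (Fintype.card (V n) : ℝ) with hN
  set E : ℝ := ((G n).edgeFinset.card : ℝ) with hE
  have hden : E / N * Real.log N ≠ 0 := by
    intro h0
    rw [h0, div_zero] at hn
    have : 0 < (3 + t) / ε := by positivity
    linarith
  have hE1 : 1 ≤ E := by
    have : E ≠ 0 := fun h => hden (by rw [h]; simp)
    rw [hE] at this ⊢
    exact_mod_cast Nat.one_le_iff_ne_zero.2 (by exact_mod_cast this)
  have hN2 : 2 ≤ N := by
    have h0 : Fintype.card (V n) ≠ 0 := fun h => hden (by rw [hN, h]; simp)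
    have h1 : Fintype.card (V n) ≠ 1 := fun h => hden (by rw [hN, h]; simp)
    rw [hN]
    exact_mod_cast (by omega : 2 ≤ Fintype.card (V n))
  have hEN : E ≤ N ^ 2 := by
    have h1 : (G n).edgeFinset.card ≤ Fintype.card (V n) ^ 2 :=
      SimpleGraph.card_edgeFinset_le_card_choose_two.trans (Nat.choose_le_pow _ _)
    rw [hE, hN]
    exact_mod_cast h1
  have hδ : 0 ≤ ε * N / E := by positivity
  have hmain := abs_wstBetaBallProb_sub_mstBallProb_le (hconn n) (hβ0 n) hδ r H w
  have herr := error_bound_le hN2 hE1 hEN hε0 ht0 hn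
  rw [Real.dist_eq, sub_zero]
  calc |wstBetaBallProb (G n) (β n) r H w - mstBallProb (G n) r H w|
      ≤ N⁻¹ * (K * (E * (ε * N / E + E * Real.exp (-β n * (ε * N / E))))) := hmain
    _ = K * (N⁻¹ * (E * (ε * N / E + E * Real.exp (-β n * (ε * N / E))))) := by ring
    _ ≤ K * (ε + ε) := by gcongr; linarith
    _ < (K + 1) * (ε + ε) := by nlinarith
    _ = η := by rw [hε]; field_simp; norm_num

end WSTPaper
end
end

section
/- If β_n ≫ n·log n, then E[L(WST^{β_n}(K_n))] → ζ(3) as n → ∞, where K_n is the complete graph on n vertices. -/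
open MeasureTheory Filter Finset

noncomputable section

set_option linter.unusedSectionVars false

namespace WSTPaper

variable {V : Type} [Fintype V] [DecidableEq V]

/-- `E[L(WST^β(Kₙ))]`: the expected total length `L(T) = Σ_{e ∈ T} U_e` of the weighted
spanning tree of the complete graph `Kₙ`, where, conditionally on the i.i.d. Uniform[0,1]
labels `U`, the tree `T` is sampled with probability proportional to `∏_{e∈T} exp(-β U_e)`. -/
def expLengthK (n : ℕ) (β : ℝ) : ℝ :=
  ∫ u : Sym2 (Fin n) → ℝ,
    (∑ T ∈ spanningTrees (⊤ : SimpleGraph (Fin n)),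
        treeWeight (fun e => Real.exp (-β * u e)) T * (∑ e ∈ T, u e)) /
      partZ (⊤ : SimpleGraph (Fin n)) (fun e => Real.exp (-β * u e))
    ∂(labelMeasure (Sym2 (Fin n)))

/-- Apéry's constant `ζ(3)`. -/
def zeta3 : ℝ := ∑' k : ℕ, ((k : ℝ) + 1)⁻¹ ^ 3

/-- Number of connected components of the graph with edge set `S`. -/
def numComp (S : Set (Sym2 V)) : ℕ :=
  Nat.card (SimpleGraph.fromEdgeSet S).ConnectedComponent

lemma numComp_mono {S S' : Set (Sym2 V)} (h : S ⊆ S') : numComp S' ≤ numComp S :=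
  Nat.card_le_card_of_surjective _
    (SimpleGraph.ConnectedComponent.surjective_map_ofLE (SimpleGraph.fromEdgeSet_mono h))

lemma reachable_insert {S : Set (Sym2 V)} {x y u v : V}
    (h : (SimpleGraph.fromEdgeSet (insert s(x, y) S)).Reachable u v) :
    (SimpleGraph.fromEdgeSet S).Reachable u v ∨
      ((SimpleGraph.fromEdgeSet S).Reachable u x ∧ (SimpleGraph.fromEdgeSet S).Reachable y v) ∨
      ((SimpleGraph.fromEdgeSet S).Reachable u y ∧ (SimpleGraph.fromEdgeSet S).Reachable x v) := by
  rw [SimpleGraph.reachable_iff_reflTransGen] at h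
  induction h with
  | refl => exact Or.inl (SimpleGraph.Reachable.refl _)
  | @tail b c _ hbc ih =>
    rw [SimpleGraph.fromEdgeSet_adj, Set.mem_insert_iff, Sym2.eq_iff] at hbc
    obtain ⟨(⟨rfl, rfl⟩ | ⟨rfl, rfl⟩) | hS, hne⟩ := hbc
    · rcases ih with ih | ih | ih
      · exact Or.inr (Or.inl ⟨ih, SimpleGraph.Reachable.refl _⟩)
      · exact Or.inr (Or.inl ⟨ih.1, SimpleGraph.Reachable.refl _⟩)
      · exact Or.inl ih.1
    · rcases ih with ih | ih | ih
      · exact Or.inr (Or.inr ⟨ih, SimpleGraph.Reachable.refl _⟩)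
      · exact Or.inl ih.1
      · exact Or.inr (Or.inr ⟨ih.1, SimpleGraph.Reachable.refl _⟩)
    · have hr : (SimpleGraph.fromEdgeSet S).Reachable b c :=
        SimpleGraph.Adj.reachable ((SimpleGraph.fromEdgeSet_adj S).2 ⟨hS, hne⟩)
      rcases ih with ih | ih | ih
      · exact Or.inl (ih.trans hr)
      · exact Or.inr (Or.inl ⟨ih.1, ih.2.trans hr⟩)
      · exact Or.inr (Or.inr ⟨ih.1, ih.2.trans hr⟩)

lemma numComp_le_insert (S : Set (Sym2 V)) (e : Sym2 V) :
    numComp S ≤ numComp (insert e S) + 1 := by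
  classical
  induction e using Sym2.ind with
  | _ x y =>
  let φ : (SimpleGraph.fromEdgeSet S).ConnectedComponent →
      Option (SimpleGraph.fromEdgeSet (insert s(x, y) S)).ConnectedComponent := fun C =>
    if C = (SimpleGraph.fromEdgeSet S).connectedComponentMk x then none
    else some (C.map (SimpleGraph.Hom.ofLE (SimpleGraph.fromEdgeSet_mono (Set.subset_insert _ _))))
  have hφ : Function.Injective φ := by
    intro C D h
    induction C using SimpleGraph.ConnectedComponent.ind with | _ u =>
    induction D using SimpleGraph.ConnectedComponent.ind with | _ v =>
    simp only [φ] at h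
    split_ifs at h with h1 h2 h2
    · rw [h1, h2]
    · simp only [SimpleGraph.ConnectedComponent.map_mk, Option.some.injEq,
        SimpleGraph.ConnectedComponent.eq, SimpleGraph.Hom.coe_ofLE, id] at h h1 h2 ⊢
      rcases reachable_insert h with h | h | h
      · exact h
      · exact absurd h.1 h1
      · exact absurd h.2.symm h2
  have := Nat.card_le_card_of_injective φ hφ
  rwa [Finite.card_option] at this

lemma numComp_insert_lt {S : Set (Sym2 V)} {x y : V}
    (h : ¬ (SimpleGraph.fromEdgeSet S).Reachable x y) :
    numComp (insert s(x, y) S) + 1 ≤ numComp S := by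
  classical
  have hle := SimpleGraph.fromEdgeSet_mono (Set.subset_insert s(x, y) S)
  have hne : x ≠ y := by
    rintro rfl
    exact h (SimpleGraph.Reachable.refl _)
  let _ := Fintype.ofFinite (SimpleGraph.fromEdgeSet S).ConnectedComponent
  let _ := Fintype.ofFinite (SimpleGraph.fromEdgeSet (insert s(x, y) S)).ConnectedComponent
  unfold numComp
  rw [Nat.card_eq_fintype_card, Nat.card_eq_fintype_card]
  refine Fintype.card_lt_of_surjective_not_injective _
    (SimpleGraph.ConnectedComponent.surjective_map_ofLE hle) fun hinj => h ?_
  have : (SimpleGraph.fromEdgeSet S).connectedComponentMk x =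
      (SimpleGraph.fromEdgeSet S).connectedComponentMk y := by
    apply hinj
    simp only [SimpleGraph.ConnectedComponent.map_mk, SimpleGraph.ConnectedComponent.eq]
    exact SimpleGraph.Adj.reachable ((SimpleGraph.fromEdgeSet_adj _).2 ⟨Set.mem_insert _ _, hne⟩)
  exact SimpleGraph.ConnectedComponent.exact this

lemma numComp_le_union (S : Set (Sym2 V)) (F : Finset (Sym2 V)) :
    numComp S ≤ numComp (S ∪ F) + #F := by
  induction F using Finset.induction_on with
  | empty => simp
  | insert e F he ih =>
    rw [Finset.coe_insert, Set.union_insert, card_insert_of_notMem he]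
    have := numComp_le_insert (S ∪ F) e
    omega

lemma numComp_le_one_of_connected {S : Set (Sym2 V)}
    (h : (SimpleGraph.fromEdgeSet S).Connected) : numComp S ≤ 1 := by
  have := h.preconnected.subsingleton_connectedComponent
  exact Finite.card_le_one_iff_subsingleton.2 this

/-- Every spanning tree has at least `numComp - 1` edges above level `p`. -/
lemma numComp_le_card_above {T : Finset (Sym2 V)}
    (hT : T ∈ spanningTrees (⊤ : SimpleGraph V)) (u : Sym2 V → ℝ) (p : ℝ) :
    numComp {e | u e ≤ p} ≤ #(T.filter fun e => p < u e) + 1 := by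
  classical
  have hT' := (Finset.mem_filter.1 hT).2.2
  refine (numComp_le_union _ (T.filter fun e => p < u e)).trans ?_
  have : numComp ({e | u e ≤ p} ∪ ↑(T.filter fun e => p < u e)) ≤ numComp (T : Set (Sym2 V)) := by
    refine numComp_mono fun e he => ?_
    rcases le_or_gt (u e) p with h | h
    · exact Or.inl h
    · exact Or.inr (by simpa using ⟨he, h⟩)
  have := numComp_le_one_of_connected hT'.connected
  omega

/-- Kruskal's algorithm: on any finite edge set there is a spanning forest with the minimal
possible number of edges above every level. -/
lemma exists_kruskal_forest (u : Sym2 V → ℝ) (S : Finset (Sym2 V)) :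
    ∃ T : Finset (Sym2 V), T ⊆ S ∧ (∀ e ∈ T, ¬ e.IsDiag) ∧
      (SimpleGraph.fromEdgeSet (T : Set (Sym2 V))).IsAcyclic ∧
      (∀ x y, (SimpleGraph.fromEdgeSet (S : Set (Sym2 V))).Reachable x y →
        (SimpleGraph.fromEdgeSet (T : Set (Sym2 V))).Reachable x y) ∧
      ∀ p : ℝ, #(T.filter fun e => p < u e) + numComp (S : Set (Sym2 V)) ≤
        numComp ((S : Set (Sym2 V)) ∩ {e | u e ≤ p}) := by
  classical
  induction S using Finset.induction_on_max_value u with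
  | empty => exact ⟨∅, by simp⟩
  | insert e S he hmax ih =>
    obtain ⟨T, hTS, hd, hac, hr, hc⟩ := ih
    have hins : ∀ p, p < u e → ((insert e S : Finset (Sym2 V)) : Set (Sym2 V)) ∩ {e | u e ≤ p} =
        (S : Set (Sym2 V)) ∩ {e | u e ≤ p} := by
      intro p hp
      ext f
      simp only [coe_insert, Set.mem_inter_iff, Set.mem_insert_iff, mem_coe, Set.mem_ofPred_eq]
      constructor
      · rintro ⟨rfl | h, h'⟩
        · exact absurd h' (not_le.2 hp)
        · exact ⟨h, h'⟩
      · exact fun h => ⟨Or.inr h.1, h.2⟩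
    have htop : ∀ p, u e ≤ p → ((insert e S : Finset (Sym2 V)) : Set (Sym2 V)) ∩ {e | u e ≤ p} =
        ((insert e S : Finset (Sym2 V)) : Set (Sym2 V)) := by
      intro p hp
      refine Set.inter_eq_left.2 fun f hf => ?_
      rcases Finset.mem_insert.1 (Finset.mem_coe.1 hf) with rfl | h
      · exact hp
      · exact (hmax f h).trans hp
    have hzero : ∀ p, u e ≤ p → T.filter (fun f => p < u f) = ∅ := by
      intro p hp
      refine Finset.filter_eq_empty_iff.2 fun f hf => not_lt.2 ?_
      exact (hmax f (hTS hf)).trans hp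
    induction e using Sym2.ind with
    | _ x y =>
    by_cases hxy : (SimpleGraph.fromEdgeSet (S : Set (Sym2 V))).Reachable x y
    · refine ⟨T, hTS.trans (Finset.subset_insert _ _), hd, hac, fun a b hab => ?_, fun p => ?_⟩
      · rw [coe_insert] at hab
        have hT := hr _ _ hxy
        rcases reachable_insert hab with h | h | h
        · exact hr _ _ h
        · exact ((hr _ _ h.1).trans hT).trans (hr _ _ h.2)
        · exact ((hr _ _ h.1).trans hT.symm).trans (hr _ _ h.2)
      · rcases lt_or_ge p (u s(x, y)) with hp | hp
        · rw [hins p hp]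
          refine le_trans ?_ (hc p)
          gcongr
          exact numComp_mono (by simp)
        · rw [htop p hp, hzero p hp]
          simp
    · have hxyT : ¬ (SimpleGraph.fromEdgeSet (T : Set (Sym2 V))).Reachable x y :=
        fun h => hxy (h.mono (SimpleGraph.fromEdgeSet_mono (by exact_mod_cast hTS)))
      have hne : x ≠ y := by
        rintro rfl
        exact hxy (SimpleGraph.Reachable.refl _)
      refine ⟨insert s(x, y) T, Finset.insert_subset_insert _ hTS, ?_, ?_, fun a b hab => ?_,
        fun p => ?_⟩
      · intro f hf
        rcases Finset.mem_insert.1 hf with rfl | h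
        · simpa using hne
        · exact hd f h
      · have := (SimpleGraph.isAcyclic_add_edge_iff_of_not_reachable x y hxyT).2 hac
        rwa [SimpleGraph.edge, ← SimpleGraph.fromEdgeSet_union, Set.union_singleton,
          ← Finset.coe_insert] at this
      · rw [coe_insert] at hab
        have hle := SimpleGraph.fromEdgeSet_mono (Set.subset_insert s(x, y) (T : Set (Sym2 V)))
        have hadj : (SimpleGraph.fromEdgeSet (insert s(x, y) (T : Set (Sym2 V)))).Reachable x y :=
          SimpleGraph.Adj.reachable
            ((SimpleGraph.fromEdgeSet_adj _).2 ⟨Set.mem_insert _ _, hne⟩)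
        rw [coe_insert]
        rcases reachable_insert hab with h | h | h
        · exact (hr _ _ h).mono hle
        · exact (((hr _ _ h.1).mono hle).trans hadj).trans ((hr _ _ h.2).mono hle)
        · exact (((hr _ _ h.1).mono hle).trans hadj.symm).trans ((hr _ _ h.2).mono hle)
      · rcases lt_or_ge p (u s(x, y)) with hp | hp
        · rw [hins p hp, coe_insert]
          have h1 := hc p
          have h2 := numComp_insert_lt hxy
          have h4 : #((insert s(x, y) T).filter fun e => p < u e) ≤
              #(T.filter fun e => p < u e) + 1 := by
            rw [Finset.filter_insert, if_pos hp]
            exact card_insert_le _ _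
          omega
        · rw [htop p hp, Finset.filter_insert, if_neg (not_lt.2 hp), hzero p hp]
          simp

/-- A minimum spanning tree: it has exactly `numComp - 1` edges above every level. -/
lemma exists_mst [Nonempty V] (u : Sym2 V → ℝ) :
    ∃ T ∈ spanningTrees (⊤ : SimpleGraph V),
      ∀ p : ℝ, #(T.filter fun e => p < u e) + 1 = numComp {e | u e ≤ p} := by
  classical
  obtain ⟨T, -, hd, hac, hr, hc⟩ := exists_kruskal_forest u (Finset.univ : Finset (Sym2 V))
  have htree : (SimpleGraph.fromEdgeSet (T : Set (Sym2 V))).IsTree := by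
    refine ⟨⟨fun x y => hr x y ?_⟩, hac⟩
    rw [Finset.coe_univ]
    by_cases hxy : x = y
    · subst hxy
      exact SimpleGraph.Reachable.refl _
    · exact SimpleGraph.Adj.reachable ((SimpleGraph.fromEdgeSet_adj _).2 ⟨Set.mem_univ _, hxy⟩)
  have hT : T ∈ spanningTrees (⊤ : SimpleGraph V) := by
    refine Finset.mem_filter.2 ⟨Finset.mem_univ _, fun e he => ?_, htree⟩
    simpa [SimpleGraph.edgeSet_top] using hd e he
  refine ⟨T, hT, fun p => le_antisymm ?_ (numComp_le_card_above hT u p)⟩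
  have h := hc p
  rw [Finset.coe_univ, Set.univ_inter] at h
  have : 0 < numComp (Set.univ : Set (Sym2 V)) := Nat.card_pos
  omega

/-- `A` is the vertex set of a connected component of the graph with edge set `S`. -/
def IsComp (S : Set (Sym2 V)) (A : Finset V) : Prop :=
  ∃ C : (SimpleGraph.fromEdgeSet S).ConnectedComponent, C.supp = (A : Set V)

/-- Inside `A`, every vertex is joined to the root set `R` by edges of `S`: no proper subset of
`A` containing `R` is closed under adjacency. -/
def Rooted (S : Set (Sym2 V)) (A R : Finset V) : Prop :=
  ∀ X : Finset V, R ⊆ X → X ⊆ A → (∀ x ∈ X, ∀ y ∈ A \ X, s(x, y) ∉ S) → X = A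

lemma IsComp.nonempty {S : Set (Sym2 V)} {A : Finset V} (h : IsComp S A) : A.Nonempty := by
  obtain ⟨C, hC⟩ := h
  rw [← Finset.coe_nonempty, ← hC]
  exact C.nonempty_supp

lemma IsComp.eq_of_mem {S : Set (Sym2 V)} {A B : Finset V} (hA : IsComp S A) (hB : IsComp S B)
    {v : V} (hvA : v ∈ A) (hvB : v ∈ B) : A = B := by
  obtain ⟨C, hC⟩ := hA
  obtain ⟨D, hD⟩ := hB
  rw [← Finset.mem_coe, ← hC] at hvA
  rw [← Finset.mem_coe, ← hD] at hvB
  rw [← Finset.coe_inj, ← hC, ← hD, ← (SimpleGraph.ConnectedComponent.mem_supp_iff _ _).1 hvA,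
    (SimpleGraph.ConnectedComponent.mem_supp_iff _ _).1 hvB]

lemma exists_isComp (S : Set (Sym2 V)) (v : V) : ∃ A : Finset V, IsComp S A ∧ v ∈ A := by
  classical
  refine ⟨((SimpleGraph.fromEdgeSet S).connectedComponentMk v).supp.toFinset,
    ⟨(SimpleGraph.fromEdgeSet S).connectedComponentMk v, ?_⟩, ?_⟩
  · simp
  · simp

open scoped Classical in
lemma numComp_eq_card (S : Set (Sym2 V)) :
    numComp S = #((Finset.univ : Finset (Finset V)).filter (IsComp S)) := by
  have := Fintype.ofFinite (SimpleGraph.fromEdgeSet S).ConnectedComponent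
  have h : (Finset.univ : Finset (Finset V)).filter (IsComp S) =
      Finset.univ.image fun C : (SimpleGraph.fromEdgeSet S).ConnectedComponent =>
        C.supp.toFinset := by
    ext A
    simp only [mem_filter, mem_univ, true_and, mem_image, IsComp]
    refine exists_congr fun C => ?_
    rw [← Finset.coe_inj, Set.coe_toFinset]
  rw [h, Finset.card_image_of_injective, Finset.card_univ, numComp, Nat.card_eq_fintype_card]
  intro C D hCD
  exact SimpleGraph.ConnectedComponent.supp_injective (by simpa using hCD)

open scoped Classical in
lemma sum_card_isComp (S : Set (Sym2 V)) :
    ∑ A ∈ (Finset.univ : Finset (Finset V)).filter (IsComp S), #A = Fintype.card V := by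
  have h : (Finset.univ : Finset V) =
      ((Finset.univ : Finset (Finset V)).filter (IsComp S)).biUnion id := by
    ext v
    simpa using exists_isComp S v
  rw [← Finset.card_univ, h, Finset.card_biUnion]
  · rfl
  · intro A hA B hB hAB
    simp only [Finset.mem_coe, mem_filter, mem_univ, true_and] at hA hB
    exact Finset.disjoint_left.2 fun v hvA hvB => hAB (hA.eq_of_mem hB hvA hvB)

open scoped Classical in
lemma card_large_isComp_le_one (S : Set (Sym2 V)) :
    #((Finset.univ : Finset (Finset V)).filter
      fun A => IsComp S A ∧ Fintype.card V < 2 * #A) ≤ 1 := by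
  refine Finset.card_le_one.2 fun A hA B hB => ?_
  simp only [mem_filter, mem_univ, true_and] at hA hB
  by_contra hne
  have hd : Disjoint A B :=
    Finset.disjoint_left.2 fun v hvA hvB => hne (hA.1.eq_of_mem hB.1 hvA hvB)
  have h1 := Finset.card_union_of_disjoint hd
  have h2 := Finset.card_le_univ (A ∪ B)
  omega

lemma isComp_iff {S : Set (Sym2 V)} {A : Finset V} {r : V} (hr : r ∈ A) :
    IsComp S A ↔ (∀ x ∈ A, ∀ y ∈ Aᶜ, s(x, y) ∉ S) ∧ Rooted S A {r} := by
  classical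
  constructor
  · rintro ⟨C, hC⟩
    have hmem : ∀ v, v ∈ A ↔ (SimpleGraph.fromEdgeSet S).connectedComponentMk v = C := by
      intro v
      rw [← Finset.mem_coe, ← hC, SimpleGraph.ConnectedComponent.mem_supp_iff]
    have hcl : ∀ x ∈ A, ∀ y ∈ Aᶜ, s(x, y) ∉ S := by
      intro x hx y hy hS
      rw [Finset.mem_compl] at hy
      refine hy ((hmem y).2 ?_)
      rw [← (hmem x).1 hx]
      by_cases hxy : x = y
      · rw [hxy]
      · exact (SimpleGraph.ConnectedComponent.sound (SimpleGraph.Adj.reachable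
          ((SimpleGraph.fromEdgeSet_adj S).2 ⟨hS, hxy⟩))).symm
    refine ⟨hcl, fun X hrX hXA hX => Finset.Subset.antisymm hXA fun a ha => ?_⟩
    have hreach : (SimpleGraph.fromEdgeSet S).Reachable r a :=
      SimpleGraph.ConnectedComponent.exact (((hmem r).1 hr).trans ((hmem a).1 ha).symm)
    rw [SimpleGraph.reachable_iff_reflTransGen] at hreach
    clear ha
    induction hreach with
    | refl => exact hrX (Finset.mem_singleton_self r)
    | @tail b c _ hbc ih =>
      have hS := ((SimpleGraph.fromEdgeSet_adj S).1 hbc).1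
      by_contra hc
      by_cases hcA : c ∈ A
      · exact hX b ih c (Finset.mem_sdiff.2 ⟨hcA, hc⟩) hS
      · exact hcl b (hXA ih) c (Finset.mem_compl.2 hcA) hS
  · rintro ⟨hcl, hR⟩
    refine ⟨(SimpleGraph.fromEdgeSet S).connectedComponentMk r, Set.Subset.antisymm ?_ ?_⟩
    · intro a ha
      have hreach : (SimpleGraph.fromEdgeSet S).Reachable r a :=
        (SimpleGraph.ConnectedComponent.exact ha).symm
      rw [SimpleGraph.reachable_iff_reflTransGen] at hreach
      clear ha
      induction hreach with
      | refl => exact hr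
      | @tail b c _ hbc ih =>
        by_contra hc
        exact hcl b ih c (by simpa using hc) ((SimpleGraph.fromEdgeSet_adj S).1 hbc).1
    · have hX := hR (A.filter fun a => (SimpleGraph.fromEdgeSet S).Reachable r a)
        (by simp [hr]) (Finset.filter_subset _ _) ?_
      · intro a ha
        rw [Finset.mem_coe, ← hX, Finset.mem_filter] at ha
        exact SimpleGraph.ConnectedComponent.sound ha.2.symm
      · intro x hx y hy hS
        rw [Finset.mem_filter] at hx
        rw [Finset.mem_sdiff, Finset.mem_filter, not_and] at hy
        refine hy.2 hy.1 ?_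
        by_cases hxy : x = y
        · exact hxy ▸ hx.2
        · exact hx.2.trans (SimpleGraph.Adj.reachable
            ((SimpleGraph.fromEdgeSet_adj S).2 ⟨hS, hxy⟩))

/-- Exposing the neighbours `N` of a root `r` among the non-roots. -/
lemma rooted_step {S : Set (Sym2 V)} {A R N : Finset V} {r : V} (hr : r ∈ R) (hRA : R ⊆ A)
    (hN : N ⊆ A \ R) (hin : ∀ x ∈ N, s(r, x) ∈ S) (hout : ∀ x ∈ (A \ R) \ N, s(r, x) ∉ S) :
    Rooted S A R ↔ Rooted S (A.erase r) (R.erase r ∪ N) := by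
  constructor
  · intro h X hRX hXA hX
    have hrX : r ∉ X := fun h' => by simpa using hXA h'
    have := h (insert r X) ?_ ?_ ?_
    · rw [← this, Finset.erase_insert hrX]
    · intro x hx
      by_cases hxr : x = r
      · exact hxr ▸ Finset.mem_insert_self _ _
      · exact Finset.mem_insert_of_mem
          (hRX (Finset.mem_union_left _ (Finset.mem_erase.2 ⟨hxr, hx⟩)))
    · intro x hx
      rcases Finset.mem_insert.1 hx with rfl | hx
      · exact hRA hr
      · exact Finset.mem_of_mem_erase (hXA hx)
    · intro x hx y hy
      simp only [Finset.mem_sdiff, mem_insert, not_or] at hy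
      rcases Finset.mem_insert.1 hx with rfl | hx
      · refine hout y ?_
        simp only [Finset.mem_sdiff]
        exact ⟨⟨hy.1, fun hyR => hy.2.2 (hRX (Finset.mem_union_left _
          (Finset.mem_erase.2 ⟨hy.2.1, hyR⟩)))⟩,
          fun hyN => hy.2.2 (hRX (Finset.mem_union_right _ hyN))⟩
      · exact hX x hx y (by simp [hy])
  · intro h X hRX hXA hX
    have := h (X.erase r) ?_ (Finset.erase_subset_erase _ hXA) ?_
    · rw [← Finset.insert_erase (hRX hr), this, Finset.insert_erase (hRA hr)]
    · intro x hx
      rcases Finset.mem_union.1 hx with hx | hx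
      · exact Finset.erase_subset_erase _ hRX hx
      · have hx' := Finset.mem_sdiff.1 (hN hx)
        refine Finset.mem_erase.2 ⟨?_, ?_⟩
        · rintro rfl
          exact hx'.2 hr
        · by_contra hxX
          exact hX r (hRX hr) x (Finset.mem_sdiff.2 ⟨hx'.1, hxX⟩) (hin x hx)
    · intro x hx y hy
      simp only [Finset.mem_sdiff, mem_erase, not_and] at hy
      exact hX x (Finset.mem_of_mem_erase hx) y
        (Finset.mem_sdiff.2 ⟨hy.1.2, hy.2 hy.1.1⟩)

lemma rooted_self (S : Set (Sym2 V)) (A : Finset V) : Rooted S A A :=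
  fun _ h h' _ => Finset.Subset.antisymm h' h

lemma not_rooted_empty (S : Set (Sym2 V)) {A : Finset V} (hA : A.Nonempty) :
    ¬ Rooted S A ∅ := fun h =>
  hA.ne_empty (h ∅ (Finset.Subset.refl _) (Finset.empty_subset _) (by simp)).symm

lemma labelMeasure_cylinder {ι : Type} [Fintype ι] [DecidableEq ι] {p : ℝ}
    (hp : p ∈ Set.Icc (0 : ℝ) 1)
    {I O : Finset ι} (hIdisj : Disjoint I O) :
    (labelMeasure ι).real {u | (∀ e ∈ I, u e ≤ p) ∧ ∀ e ∈ O, ¬ u e ≤ p} =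
      p ^ #I * (1 - p) ^ #O := by
  have hset : {u : ι → ℝ | (∀ e ∈ I, u e ≤ p) ∧ ∀ e ∈ O, ¬ u e ≤ p} =
      Set.pi Set.univ fun e => if e ∈ I then Set.Iic p else if e ∈ O then Set.Ioi p else Set.univ := by
    ext u
    simp only [Set.mem_ofPred_eq, Set.mem_pi, Set.mem_univ, true_implies]
    constructor
    · rintro ⟨h1, h2⟩ e
      split_ifs with hI hO
      · exact h1 e hI
      · exact not_le.1 (h2 e hO)
      · trivial
    · intro h
      refine ⟨fun e he => ?_, fun e he => ?_⟩
      · simpa [he] using h e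
      · have := h e
        rw [if_neg (Finset.disjoint_right.1 hIdisj he), if_pos he] at this
        exact not_le.2 this
  have hIic : (volume.restrict (Set.Icc (0 : ℝ) 1)) (Set.Iic p) = ENNReal.ofReal p := by
    rw [Measure.restrict_apply measurableSet_Iic]
    have : Set.Iic p ∩ Set.Icc (0 : ℝ) 1 = Set.Icc 0 p := by
      ext x
      simp only [Set.mem_inter_iff, Set.mem_Iic, Set.mem_Icc]
      exact ⟨fun h => ⟨h.2.1, h.1⟩, fun h => ⟨h.2, h.1, h.2.trans hp.2⟩⟩
    rw [this, Real.volume_Icc, sub_zero]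
  have hIoi : (volume.restrict (Set.Icc (0 : ℝ) 1)) (Set.Ioi p) = ENNReal.ofReal (1 - p) := by
    rw [Measure.restrict_apply measurableSet_Ioi]
    have : Set.Ioi p ∩ Set.Icc (0 : ℝ) 1 = Set.Ioc p 1 := by
      ext x
      simp only [Set.mem_inter_iff, Set.mem_Ioi, Set.mem_Icc, Set.mem_Ioc]
      exact ⟨fun h => ⟨h.1, h.2.2⟩, fun h => ⟨h.1, hp.1.trans h.1.le, h.2⟩⟩
    rw [this, Real.volume_Ioc]
  have huniv : (volume.restrict (Set.Icc (0 : ℝ) 1)) Set.univ = 1 := by simp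
  rw [hset, Measure.real, labelMeasure, Measure.pi_pi, ENNReal.toReal_prod]
  have hval : ∀ e, ((volume.restrict (Set.Icc (0 : ℝ) 1))
      (if e ∈ I then Set.Iic p else if e ∈ O then Set.Ioi p else Set.univ)).toReal =
      (if e ∈ I then p else 1) * (if e ∈ O then 1 - p else 1) := by
    intro e
    by_cases hI : e ∈ I
    · have hO : e ∉ O := Finset.disjoint_left.1 hIdisj hI
      simp only [hI, hO, if_true, if_false, hIic, mul_one]
      exact ENNReal.toReal_ofReal hp.1
    · by_cases hO : e ∈ O
      · simp only [hI, hO, if_true, if_false, hIoi, one_mul]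
        exact ENNReal.toReal_ofReal (sub_nonneg.2 hp.2)
      · simp [hI, hO]
  rw [Finset.prod_congr rfl fun e _ => hval e, Finset.prod_mul_distrib]
  simp [Finset.prod_ite_mem]

/-- Any event depending only on the sublevel set of the labels is jointly measurable. -/
lemma measurableSet_sublevel_prod {ι : Type} [Fintype ι] (P : Set ι → Prop) :
    MeasurableSet {z : (ι → ℝ) × ℝ | P {e | z.1 e ≤ z.2}} := by
  classical
  have : {z : (ι → ℝ) × ℝ | P {e | z.1 e ≤ z.2}} =
      ⋃ S ∈ {S : Set ι | P S}, ⋂ e, {z : (ι → ℝ) × ℝ | z.1 e ≤ z.2 ↔ e ∈ S} := by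
    ext z
    simp only [Set.mem_ofPred_eq, Set.mem_iUnion, Set.mem_iInter, exists_prop]
    constructor
    · exact fun h => ⟨_, h, fun e => Iff.rfl⟩
    · rintro ⟨S, hS, h⟩
      have : {e | z.1 e ≤ z.2} = S := Set.ext h
      rwa [this]
  rw [this]
  refine MeasurableSet.biUnion (Set.toFinite _).countable fun S _ => MeasurableSet.iInter fun e => ?_
  have hm : MeasurableSet {z : (ι → ℝ) × ℝ | z.1 e ≤ z.2} :=
    measurableSet_le ((measurable_pi_apply e).comp measurable_fst) measurable_snd
  by_cases he : e ∈ S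
  · simpa [he] using hm
  · have h' := hm.compl
    simpa [he, Set.compl_def] using h'

lemma measurableSet_sublevel {ι : Type} [Fintype ι] (P : Set ι → Prop) (p : ℝ) :
    MeasurableSet {u : ι → ℝ | P {e | u e ≤ p}} :=
  (measurable_id.prodMk measurable_const) (measurableSet_sublevel_prod P)

/-- The probability that, in an Erdős–Rényi graph on `m` vertices with edge probability `p`
and `q = 1 - p`, each of `s` vertices is joined to one of the other `m - s`. -/
def connProb (p q : ℝ) : ℕ → ℕ → ℝ
  | 0, _ => 1
  | m + 1, s => if s = m + 1 then 0 else
      ∑ i ∈ Finset.range (s + 1), (s.choose i : ℝ) * (p ^ i * q ^ (s - i) * connProb p q m (s - i))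

lemma measureReal_rooted {p : ℝ} (hp : p ∈ Set.Icc (0 : ℝ) 1) (m : ℕ) :
    ∀ (A R : Finset V) (I O : Finset (Sym2 V)), #A = m → R ⊆ A → Disjoint I O →
      (∀ e ∈ I, ∃ v ∈ e, v ∉ A) → (∀ e ∈ O, ∃ v ∈ e, v ∉ A) →
      (labelMeasure (Sym2 V)).real {u | (∀ e ∈ I, u e ≤ p) ∧ (∀ e ∈ O, ¬ u e ≤ p) ∧
        Rooted {e | u e ≤ p} A R} =
      p ^ #I * (1 - p) ^ #O * connProb p (1 - p) m #(A \ R) := by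
  induction m with
  | zero =>
    intro A R I O hA hRA hIdisj _ _
    obtain rfl := Finset.card_eq_zero.1 hA
    obtain rfl := Finset.subset_empty.1 hRA
    simp only [rooted_self, and_true, connProb, mul_one]
    exact labelMeasure_cylinder hp hIdisj
  | succ m ih =>
    intro A R I O hA hRA hIdisj hI hO
    rcases R.eq_empty_or_nonempty with rfl | ⟨r, hr⟩
    · have hne : A.Nonempty := Finset.card_pos.1 (by omega)
      simp only [not_rooted_empty _ hne, and_false, Finset.sdiff_empty, hA, connProb, if_true,
        mul_zero]
      simp
    have hrA := hRA hr
    have hs : #(A \ R) ≠ m + 1 := by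
      have := Finset.card_sdiff_add_card_eq_card hRA
      have := Finset.card_pos.2 ⟨r, hr⟩
      omega
    let J : Finset V → Finset (Sym2 V) := fun N => N.image fun x => s(r, x)
    have hJmem : ∀ N x, s(r, x) ∈ J N ↔ x ∈ N := by
      intro N x
      simp only [J, Finset.mem_image]
      constructor
      · rintro ⟨y, hy, h⟩
        rwa [← Sym2.congr_right.1 h]
      · exact fun h => ⟨x, h, rfl⟩
    have hJcard : ∀ N, #(J N) = #N := fun N =>
      Finset.card_image_of_injective _ fun x y h => Sym2.congr_right.1 h
    have hJforall : ∀ N (Q : Sym2 V → Prop), (∀ e ∈ J N, Q e) ↔ ∀ x ∈ N, Q s(r, x) := by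
      intro N Q
      simp [J]
    have hJA : ∀ N ⊆ A \ R, ∀ e ∈ J N, ∀ v ∈ e, v ∈ A := by
      intro N hN
      rw [hJforall]
      intro x hx v hv
      rcases Sym2.mem_iff.1 hv with rfl | rfl
      · exact hrA
      · exact (Finset.mem_sdiff.1 (hN hx)).1
    have hdisj : ∀ (K : Finset (Sym2 V)), (∀ e ∈ K, ∃ v ∈ e, v ∉ A) → ∀ N ⊆ A \ R,
        Disjoint K (J N) := by
      intro K hK N hN
      refine Finset.disjoint_left.2 fun e heK heJ => ?_
      obtain ⟨v, hv, hvA⟩ := hK e heK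
      exact hvA (hJA N hN e heJ v hv)
    have hset : {u : Sym2 V → ℝ | (∀ e ∈ I, u e ≤ p) ∧ (∀ e ∈ O, ¬ u e ≤ p) ∧
          Rooted {e | u e ≤ p} A R} =
        ⋃ N ∈ (A \ R).powerset, {u | (∀ e ∈ I ∪ J N, u e ≤ p) ∧
          (∀ e ∈ O ∪ J ((A \ R) \ N), ¬ u e ≤ p) ∧
          Rooted {e | u e ≤ p} (A.erase r) (R.erase r ∪ N)} := by
      ext u
      simp only [Set.mem_ofPred_eq, Set.mem_iUnion, exists_prop, Finset.mem_powerset,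
        Finset.forall_mem_union, hJforall]
      constructor
      · rintro ⟨h1, h2, h3⟩
        refine ⟨(A \ R).filter fun x => u s(r, x) ≤ p, Finset.filter_subset _ _,
          ⟨h1, fun x hx => (Finset.mem_filter.1 hx).2⟩, ⟨h2, fun x hx => ?_⟩, ?_⟩
        · rw [Finset.mem_sdiff, Finset.mem_filter, not_and] at hx
          exact hx.2 hx.1
        · refine (rooted_step hr hRA (Finset.filter_subset _ _)
            (fun x hx => (Finset.mem_filter.1 hx).2) fun x hx => ?_).1 h3
          rw [Finset.mem_sdiff, Finset.mem_filter, not_and] at hx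
          exact hx.2 hx.1
      · rintro ⟨N, hN, ⟨h1, h1'⟩, ⟨h2, h2'⟩, h3⟩
        exact ⟨h1, h2, (rooted_step hr hRA hN h1' h2').2 h3⟩
    have hterm : ∀ N ∈ (A \ R).powerset, (labelMeasure (Sym2 V)).real
        {u | (∀ e ∈ I ∪ J N, u e ≤ p) ∧
          (∀ e ∈ O ∪ J ((A \ R) \ N), ¬ u e ≤ p) ∧
          Rooted {e | u e ≤ p} (A.erase r) (R.erase r ∪ N)} =
        p ^ #I * (1 - p) ^ #O * (p ^ #N * (1 - p) ^ (#(A \ R) - #N) *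
          connProb p (1 - p) m (#(A \ R) - #N)) := by
      intro N hN
      rw [Finset.mem_powerset] at hN
      have hsd : (A \ R) \ N ⊆ A \ R := Finset.sdiff_subset
      have hout : ∀ K : Finset (Sym2 V), (∀ e ∈ K, ∃ v ∈ e, v ∉ A) → ∀ M,
          ∀ e ∈ K ∪ J M, ∃ v ∈ e, v ∉ A.erase r := by
        intro K hK M e he
        rcases Finset.mem_union.1 he with he | he
        · obtain ⟨v, hv, hvA⟩ := hK e he
          exact ⟨v, hv, fun h => hvA (Finset.mem_of_mem_erase h)⟩
        · revert e
          rw [Finset.forall_mem_union]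
          refine ⟨fun e he => ?_, ?_⟩
          · obtain ⟨v, hv, hvA⟩ := hK e he
            exact fun _ => ⟨v, hv, fun h => hvA (Finset.mem_of_mem_erase h)⟩
          · rw [hJforall]
            exact fun x _ _ => ⟨r, Sym2.mem_mk_left _ _, Finset.notMem_erase _ _⟩
      have hcard : (A.erase r) \ (R.erase r ∪ N) = (A \ R) \ N := by
        ext x
        simp only [Finset.mem_sdiff, Finset.mem_erase, Finset.mem_union]
        have : x ∉ R → x ≠ r := by
          rintro h rfl
          exact h hr
        tauto
      rw [ih (A.erase r) (R.erase r ∪ N) _ _ (by rw [Finset.card_erase_of_mem hrA, hA]; rfl) ?_ ?_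
        (hout I hI N) (hout O hO _), hcard, Finset.card_sdiff_of_subset hN,
        Finset.card_union_of_disjoint (hdisj I hI N hN),
        Finset.card_union_of_disjoint (hdisj O hO _ hsd), hJcard, hJcard,
        Finset.card_sdiff_of_subset hN, pow_add, pow_add]
      · ring
      · refine Finset.union_subset (Finset.erase_subset_erase _ hRA) fun x hx => ?_
        have := Finset.mem_sdiff.1 (hN hx)
        refine Finset.mem_erase.2 ⟨?_, this.1⟩
        rintro rfl
        exact this.2 hr
      · rw [Finset.disjoint_union_left, Finset.disjoint_union_right, Finset.disjoint_union_right]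
        refine ⟨⟨hIdisj, hdisj I hI _ hsd⟩, (hdisj O hO N hN).symm, ?_⟩
        rw [Finset.disjoint_left, hJforall]
        intro x hx
        rw [hJmem, Finset.mem_sdiff]
        exact fun h => h.2 hx
    rw [hset, measureReal_biUnion_finset, Finset.sum_congr rfl hterm, ← Finset.mul_sum,
      Finset.sum_powerset_apply_card (fun i => p ^ i * (1 - p) ^ (#(A \ R) - i) *
          connProb p (1 - p) m (#(A \ R) - i)), connProb, if_neg hs]
    · simp only [nsmul_eq_mul]
    · intro N hN N' hN' hne
      refine Set.disjoint_left.2 fun u hu hu' => hne ?_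
      simp only [Finset.coe_powerset, Set.mem_preimage, Set.mem_powerset_iff,
        Finset.coe_subset] at hN hN'
      simp only [Set.mem_ofPred_eq, Finset.forall_mem_union, hJforall] at hu hu'
      ext x
      constructor
      · intro hx
        by_contra hx'
        exact hu'.2.1.2 x (Finset.mem_sdiff.2 ⟨hN hx, hx'⟩) (hu.1.2 x hx)
      · intro hx
        by_contra hx'
        exact hu.2.1.2 x (Finset.mem_sdiff.2 ⟨hN' hx, hx'⟩) (hu'.1.2 x hx)
    · intro N _
      exact measurableSet_sublevel (fun S : Set (Sym2 V) => (∀ e ∈ I ∪ J N, e ∈ S) ∧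
        (∀ e ∈ O ∪ J ((A \ R) \ N), e ∉ S) ∧ Rooted S (A.erase r) (R.erase r ∪ N)) p

lemma measureReal_isComp {p : ℝ} (hp : p ∈ Set.Icc (0 : ℝ) 1) {A : Finset V} (hA : A.Nonempty) :
    (labelMeasure (Sym2 V)).real {u | IsComp {e | u e ≤ p} A} =
      (1 - p) ^ (#A * (Fintype.card V - #A)) * connProb p (1 - p) #A (#A - 1) := by
  obtain ⟨r, hr⟩ := hA
  have h := measureReal_rooted hp #A A {r} ∅ ((A ×ˢ Aᶜ).image fun z => s(z.1, z.2)) rfl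
    (Finset.singleton_subset_iff.2 hr) (Finset.disjoint_empty_left _) (by simp) ?_
  · have hcard : #((A ×ˢ Aᶜ).image fun z => s(z.1, z.2)) = #A * (Fintype.card V - #A) := by
      rw [Finset.card_image_of_injOn, Finset.card_product, Finset.card_compl]
      rintro ⟨x, y⟩ h ⟨x', y'⟩ h' heq
      simp only [Finset.mem_coe, Finset.mem_product, Finset.mem_compl] at h h'
      rcases Sym2.eq_iff.1 heq with ⟨rfl, rfl⟩ | ⟨rfl, rfl⟩
      · rfl
      · exact absurd h'.1 h.2
    rw [hcard, Finset.card_empty, pow_zero, one_mul,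
      Finset.card_sdiff_of_subset (Finset.singleton_subset_iff.2 hr), Finset.card_singleton] at h
    rw [← h]
    congr 1
    ext u
    simp only [Set.mem_ofPred_eq, isComp_iff hr, Finset.notMem_empty, false_implies, implies_true,
      true_and, Finset.forall_mem_image, Finset.mem_product, Prod.forall]
    exact and_congr_left fun _ => ⟨fun h x y hxy => h x hxy.1 y hxy.2,
      fun h x hx y hy => h x y ⟨hx, hy⟩⟩
  · simp only [Finset.forall_mem_image, Finset.mem_product, Prod.forall, Finset.mem_compl]
    exact fun x y h => ⟨y, Sym2.mem_mk_right _ _, h.2⟩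

/-- Expected number of components of size `k` in an Erdős–Rényi graph with parameters `n, p`. -/
def compExp (n k : ℕ) (p : ℝ) : ℝ :=
  (n.choose k : ℝ) * ((1 - p) ^ (k * (n - k)) * connProb p (1 - p) k (k - 1))

open scoped Classical in
lemma integral_sum_isComp {p : ℝ} (hp : p ∈ Set.Icc (0 : ℝ) 1) (f : ℕ → ℝ) :
    ∫ u, (∑ A ∈ (Finset.univ : Finset (Finset V)).filter (IsComp {e | u e ≤ p}), f #A)
      ∂labelMeasure (Sym2 V) =
    ∑ k ∈ Finset.Icc 1 (Fintype.card V), f k * compExp (Fintype.card V) k p := by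
  have h1 : ∀ u : Sym2 V → ℝ,
      ∑ A ∈ (Finset.univ : Finset (Finset V)).filter (IsComp {e | u e ≤ p}), f #A =
      ∑ A : Finset V, {u : Sym2 V → ℝ | IsComp {e | u e ≤ p} A}.indicator (fun _ => f #A) u := by
    intro u
    rw [Finset.sum_filter]
    rfl
  have hmeas : ∀ A : Finset V, MeasurableSet {u : Sym2 V → ℝ | IsComp {e | u e ≤ p} A} :=
    fun A => measurableSet_sublevel (fun S : Set (Sym2 V) => IsComp S A) p
  simp_rw [h1]
  rw [integral_finsetSum _ fun A _ => (integrable_const _).indicator (hmeas A)]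
  have h2 : ∀ A : Finset V, ∫ u, {u : Sym2 V → ℝ | IsComp {e | u e ≤ p} A}.indicator
      (fun _ => f #A) u ∂labelMeasure (Sym2 V) =
      if #A = 0 then 0 else f #A * ((1 - p) ^ (#A * (Fintype.card V - #A)) *
        connProb p (1 - p) #A (#A - 1)) := by
    intro A
    rw [integral_indicator_const _ (hmeas A), smul_eq_mul]
    split_ifs with h
    · have : {u : Sym2 V → ℝ | IsComp {e | u e ≤ p} A} = ∅ := by
        refine Set.eq_empty_of_forall_notMem fun u hu => ?_
        exact hu.nonempty.ne_empty (Finset.card_eq_zero.1 h)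
      simp [this]
    · rw [measureReal_isComp hp (Finset.card_pos.1 (Nat.pos_of_ne_zero h)), mul_comm]
  simp_rw [h2]
  rw [← Finset.powerset_univ, Finset.sum_powerset_apply_card (fun k => if k = 0 then 0 else
    f k * ((1 - p) ^ (k * (Fintype.card V - k)) * connProb p (1 - p) k (k - 1))),
    Finset.card_univ]
  symm
  refine Finset.sum_subset_zero_on_sdiff (fun k hk => ?_) (fun k hk => ?_) fun k hk => ?_
  · rw [Finset.mem_Icc] at hk
    exact Finset.mem_range.2 (by omega)
  · rw [Finset.mem_sdiff, Finset.mem_range, Finset.mem_Icc] at hk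
    rw [if_pos (by omega), smul_zero]
  · rw [Finset.mem_Icc] at hk
    rw [if_neg (by omega), compExp, nsmul_eq_mul]
    ring

lemma integral_numComp {p : ℝ} (hp : p ∈ Set.Icc (0 : ℝ) 1) :
    ∫ u, (numComp {e | u e ≤ p} : ℝ) ∂labelMeasure (Sym2 V) =
      ∑ k ∈ Finset.Icc 1 (Fintype.card V), compExp (Fintype.card V) k p := by
  classical
  have := integral_sum_isComp (V := V) hp fun _ => 1
  simp only [one_mul] at this
  rw [← this]
  congr 1
  ext u
  rw [numComp_eq_card]
  simp

lemma sum_mul_compExp {p : ℝ} (hp : p ∈ Set.Icc (0 : ℝ) 1) (n : ℕ) :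
    ∑ k ∈ Finset.Icc 1 n, (k : ℝ) * compExp n k p = n := by
  classical
  have h := integral_sum_isComp (V := Fin n) hp fun k => (k : ℝ)
  rw [Fintype.card_fin] at h
  rw [← h]
  have : ∀ u : Sym2 (Fin n) → ℝ,
      ∑ A ∈ (Finset.univ : Finset (Finset (Fin n))).filter (IsComp {e | u e ≤ p}), (#A : ℝ) =
        n := by
    intro u
    have := sum_card_isComp {e | u e ≤ p}
    rw [Fintype.card_fin] at this
    exact_mod_cast this
  simp_rw [this]
  simp

lemma sum_large_compExp_le_one {p : ℝ} (hp : p ∈ Set.Icc (0 : ℝ) 1) (n : ℕ) :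
    ∑ k ∈ (Finset.Icc 1 n).filter (fun k => n < 2 * k), compExp n k p ≤ 1 := by
  classical
  have h := integral_sum_isComp (V := Fin n) hp fun k => if n < 2 * k then 1 else 0
  rw [Fintype.card_fin] at h
  simp only [ite_mul, one_mul, zero_mul] at h
  rw [Finset.sum_filter, ← h]
  have hle : ∀ u : Sym2 (Fin n) → ℝ,
      ∑ A ∈ (Finset.univ : Finset (Finset (Fin n))).filter (IsComp {e | u e ≤ p}),
        (if n < 2 * #A then (1 : ℝ) else 0) ≤ 1 := by
    intro u
    have := card_large_isComp_le_one {e | u e ≤ p}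
    rw [Fintype.card_fin] at this
    rw [← Finset.sum_filter, Finset.sum_const, nsmul_eq_mul, mul_one, Finset.filter_filter]
    exact_mod_cast this
  calc _ ≤ ∫ _, (1 : ℝ) ∂labelMeasure (Sym2 (Fin n)) :=
        integral_mono_of_nonneg (ae_of_all _ fun u => Finset.sum_nonneg fun A _ => by positivity)
          (integrable_const _) (ae_of_all _ hle)
    _ = 1 := by simp

lemma sum_choose_mul_pow (s : ℕ) (x : ℝ) :
    (x + 1) * ∑ i ∈ Finset.range (s + 1), (s.choose i : ℝ) * ((i : ℝ) * x ^ (s - i)) =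
      s * (x + 1) ^ s := by
  cases s with
  | zero => simp
  | succ t =>
    rw [Finset.sum_range_succ']
    have h : ∀ i ∈ Finset.range (t + 1), ((t + 1).choose (i + 1) : ℝ) *
        (((i + 1 : ℕ) : ℝ) * x ^ (t + 1 - (i + 1))) =
        ((t + 1 : ℕ) : ℝ) * (1 ^ i * x ^ (t - i) * (t.choose i : ℝ)) := by
      intro i _
      have := Nat.add_one_mul_choose_eq t i
      have h' : ((t + 1 : ℕ) : ℝ) * (t.choose i : ℝ) =
        ((t + 1).choose (i + 1) : ℝ) * ((i + 1 : ℕ) : ℝ) := by exact_mod_cast this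
      rw [Nat.add_sub_add_right, one_pow, one_mul]
      linear_combination -(x ^ (t - i)) * h'
    rw [Finset.sum_congr rfl h, ← Finset.mul_sum, ← add_pow]
    push_cast
    ring

/-- The Abel-type identity behind Cayley's formula for rooted forests. -/
lemma sum_choose_mul_forest (s : ℕ) (m : ℝ) :
    (m + 1) * ∑ i ∈ Finset.range (s + 1), (s.choose i : ℝ) * ((m - s + i) * m ^ (s - i)) =
      m * ((m + 1 - s) * (m + 1) ^ s) := by
  have h : ∑ i ∈ Finset.range (s + 1), (s.choose i : ℝ) * ((m - s + i) * m ^ (s - i)) =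
      (m - s) * ∑ i ∈ Finset.range (s + 1), 1 ^ i * m ^ (s - i) * (s.choose i : ℝ) +
      ∑ i ∈ Finset.range (s + 1), (s.choose i : ℝ) * ((i : ℝ) * m ^ (s - i)) := by
    rw [Finset.mul_sum, ← Finset.sum_add_distrib]
    refine Finset.sum_congr rfl fun i _ => ?_
    ring
  rw [h, ← add_pow, mul_add, sum_choose_mul_pow]
  ring

lemma connProb_nonneg {p q : ℝ} (hp : 0 ≤ p) (hq : 0 ≤ q) (m : ℕ) :
    ∀ s, 0 ≤ connProb p q m s := by
  induction m with
  | zero => intro s; simp [connProb]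
  | succ m ih =>
    intro s
    rw [connProb]
    split_ifs
    · exact le_rfl
    · exact Finset.sum_nonneg fun i _ => by have := ih (s - i); positivity

lemma connProb_one (p q : ℝ) : connProb p q 1 0 = 1 := by
  simp [connProb]

lemma connProb_upper {p q : ℝ} (hp : 0 ≤ p) (hq : 0 ≤ q) (hq1 : q ≤ 1) (m : ℕ) :
    ∀ s ≤ m, m * connProb p q m s ≤ (m - s) * m ^ s * p ^ s := by
  induction m with
  | zero =>
    intro s hs
    obtain rfl : s = 0 := by omega
    simp
  | succ m ih =>
    intro s hs
    rcases hs.eq_or_lt with rfl | hs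
    · simp [connProb]
    rcases m.eq_zero_or_pos with rfl | hm
    · obtain rfl : s = 0 := by omega
      simp [connProb_one]
    have hm' : (0 : ℝ) < m := by exact_mod_cast hm
    rw [connProb, if_neg (by omega)]
    have hterm : ∀ i ∈ Finset.range (s + 1),
        (s.choose i : ℝ) * (p ^ i * q ^ (s - i) * connProb p q m (s - i)) ≤
        (m : ℝ)⁻¹ * p ^ s * ((s.choose i : ℝ) * ((m - s + i) * (m : ℝ) ^ (s - i))) := by
      intro i hi
      have hi' : i ≤ s := by simpa [Nat.lt_succ_iff] using hi
      have h1 := ih (s - i) (by omega)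
      rw [Nat.cast_sub hi'] at h1
      have hps : p ^ s = p ^ i * p ^ (s - i) := by rw [← pow_add]; congr 1; omega
      have hq' : q ^ (s - i) ≤ 1 := pow_le_one₀ hq hq1
      have hc := connProb_nonneg hp hq m (s - i)
      have h2 : connProb p q m (s - i) ≤
          (m : ℝ)⁻¹ * ((m - (s - i)) * (m : ℝ) ^ (s - i) * p ^ (s - i)) := by
        rw [inv_mul_eq_div, le_div_iff₀ hm', mul_comm]
        exact h1
      calc (s.choose i : ℝ) * (p ^ i * q ^ (s - i) * connProb p q m (s - i))
          ≤ (s.choose i : ℝ) * (p ^ i * 1 * ((m : ℝ)⁻¹ *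
            ((m - (s - i)) * (m : ℝ) ^ (s - i) * p ^ (s - i)))) := by gcongr
        _ = _ := by rw [hps]; ring
    calc ((m + 1 : ℕ) : ℝ) * ∑ i ∈ Finset.range (s + 1),
          (s.choose i : ℝ) * (p ^ i * q ^ (s - i) * connProb p q m (s - i))
        ≤ ((m + 1 : ℕ) : ℝ) * ∑ i ∈ Finset.range (s + 1),
          (m : ℝ)⁻¹ * p ^ s * ((s.choose i : ℝ) * ((m - s + i) * (m : ℝ) ^ (s - i))) := by
          exact mul_le_mul_of_nonneg_left (Finset.sum_le_sum hterm) (by positivity)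
      _ = (m : ℝ)⁻¹ * p ^ s * (((m : ℝ) + 1) * ∑ i ∈ Finset.range (s + 1),
          ((s.choose i : ℝ) * ((m - s + i) * (m : ℝ) ^ (s - i)))) := by
          rw [← Finset.mul_sum]; push_cast; ring
      _ = _ := by
          rw [sum_choose_mul_forest]
          push_cast
          field_simp

lemma connProb_lower {p q : ℝ} (hp : 0 ≤ p) (hq : 0 ≤ q) (hq1 : q ≤ 1) (m : ℕ) :
    ∀ s ≤ m, (m - s) * m ^ s * p ^ s * q ^ (m ^ 2) ≤ m * connProb p q m s := by
  induction m with
  | zero =>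
    intro s hs
    obtain rfl : s = 0 := by omega
    simp
  | succ m ih =>
    intro s hs
    rcases hs.eq_or_lt with rfl | hs
    · simp [connProb]
    rcases m.eq_zero_or_pos with rfl | hm
    · obtain rfl : s = 0 := by omega
      simpa [connProb_one] using hq1
    have hm' : (0 : ℝ) < m := by exact_mod_cast hm
    rw [connProb, if_neg (by omega)]
    have hsm : (s : ℝ) ≤ m := by exact_mod_cast Nat.lt_succ_iff.1 hs
    have hterm : ∀ i ∈ Finset.range (s + 1),
        (m : ℝ)⁻¹ * p ^ s * q ^ ((m + 1) ^ 2) *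
          ((s.choose i : ℝ) * ((m - s + i) * (m : ℝ) ^ (s - i))) ≤
        (s.choose i : ℝ) * (p ^ i * q ^ (s - i) * connProb p q m (s - i)) := by
      intro i hi
      have hi' : i ≤ s := by simpa [Nat.lt_succ_iff] using hi
      have h1 := ih (s - i) (by omega)
      rw [Nat.cast_sub hi'] at h1
      have hps : p ^ s = p ^ i * p ^ (s - i) := by rw [← pow_add]; congr 1; omega
      have hqq : q ^ ((m + 1) ^ 2) ≤ q ^ (s - i) * q ^ (m ^ 2) := by
        rw [← pow_add]
        refine pow_le_pow_of_le_one hq hq1 ?_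
        have : (m + 1) ^ 2 = m ^ 2 + 2 * m + 1 := by ring
        omega
      have h2 : (m : ℝ)⁻¹ * ((m - (s - i)) * (m : ℝ) ^ (s - i) * p ^ (s - i) * q ^ (m ^ 2)) ≤
          connProb p q m (s - i) := by
        rw [inv_mul_eq_div, div_le_iff₀ hm', mul_comm _ (m : ℝ)]
        exact h1
      have hnn : (0 : ℝ) ≤ m - s + i := by
        have : (0 : ℝ) ≤ i := by positivity
        linarith
      calc _ ≤ (m : ℝ)⁻¹ * p ^ s * (q ^ (s - i) * q ^ (m ^ 2)) *
          ((s.choose i : ℝ) * ((m - s + i) * (m : ℝ) ^ (s - i))) := by gcongr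
        _ = (s.choose i : ℝ) * (p ^ i * q ^ (s - i) * ((m : ℝ)⁻¹ *
            ((m - (s - i)) * (m : ℝ) ^ (s - i) * p ^ (s - i) * q ^ (m ^ 2)))) := by
            rw [hps]; ring
        _ ≤ _ := by gcongr
    calc _ = (m : ℝ)⁻¹ * p ^ s * q ^ ((m + 1) ^ 2) * (((m : ℝ) + 1) *
          ∑ i ∈ Finset.range (s + 1),
          ((s.choose i : ℝ) * ((m - s + i) * (m : ℝ) ^ (s - i)))) := by
          rw [sum_choose_mul_forest]
          push_cast
          field_simp
      _ = ((m + 1 : ℕ) : ℝ) * ∑ i ∈ Finset.range (s + 1),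
          (m : ℝ)⁻¹ * p ^ s * q ^ ((m + 1) ^ 2) *
          ((s.choose i : ℝ) * ((m - s + i) * (m : ℝ) ^ (s - i))) := by
          rw [← Finset.mul_sum]; push_cast; ring
      _ ≤ _ := by
          exact mul_le_mul_of_nonneg_left (Finset.sum_le_sum hterm) (by positivity)

lemma continuous_connProb (m : ℕ) : ∀ s, Continuous fun p : ℝ => connProb p (1 - p) m s := by
  induction m with
  | zero => intro s; simpa [connProb] using continuous_const
  | succ m ih =>
    intro s
    simp only [connProb]
    split_ifs
    · exact continuous_const
    · refine continuous_finsetSum _ fun i _ => ?_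
      have := ih (s - i)
      fun_prop

lemma continuous_compExp (n k : ℕ) : Continuous (compExp n k) := by
  have := continuous_connProb k (k - 1)
  unfold compExp
  fun_prop

lemma compExp_nonneg {p : ℝ} (hp : p ∈ Set.Icc (0 : ℝ) 1) (n k : ℕ) : 0 ≤ compExp n k p := by
  have h := sub_nonneg.2 hp.2
  have := connProb_nonneg hp.1 h k (k - 1)
  unfold compExp
  positivity

/-- `k ^ (k - 2) * C(n, k)`, the number of trees on `k` of `n` labelled vertices. -/
def treeCount (n k : ℕ) : ℝ := n.choose k * ((k : ℝ) ^ (k - 1) / k)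

lemma treeCount_nonneg (n k : ℕ) : 0 ≤ treeCount n k := by
  unfold treeCount
  positivity

lemma compExp_upper {p : ℝ} (hp : p ∈ Set.Icc (0 : ℝ) 1) (n : ℕ) {k : ℕ} (hk : 1 ≤ k) :
    compExp n k p ≤ treeCount n k * (p ^ (k - 1) * (1 - p) ^ (k * (n - k))) := by
  have hk' : (0 : ℝ) < k := by exact_mod_cast hk
  have hq := sub_nonneg.2 hp.2
  have h := connProb_upper hp.1 hq (by linarith [hp.1]) k (k - 1) (by omega)
  rw [Nat.cast_sub hk, Nat.cast_one, sub_sub_cancel, one_mul] at h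
  have h2 : connProb p (1 - p) k (k - 1) ≤ (k : ℝ) ^ (k - 1) * p ^ (k - 1) / k := by
    rw [le_div_iff₀ hk', mul_comm]
    exact h
  calc compExp n k p ≤ (n.choose k : ℝ) * ((1 - p) ^ (k * (n - k)) *
        ((k : ℝ) ^ (k - 1) * p ^ (k - 1) / k)) := by unfold compExp; gcongr
    _ = _ := by unfold treeCount; ring

lemma compExp_lower {p : ℝ} (hp : p ∈ Set.Icc (0 : ℝ) 1) {n k : ℕ} (hk : 1 ≤ k) (hkn : k ≤ n) :
    treeCount n k * (p ^ (k - 1) * (1 - p) ^ (k * n)) ≤ compExp n k p := by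
  have hk' : (0 : ℝ) < k := by exact_mod_cast hk
  have hq := sub_nonneg.2 hp.2
  have h := connProb_lower hp.1 hq (by linarith [hp.1]) k (k - 1) (by omega)
  rw [Nat.cast_sub hk, Nat.cast_one, sub_sub_cancel, one_mul] at h
  have h2 : (k : ℝ) ^ (k - 1) * p ^ (k - 1) * (1 - p) ^ (k ^ 2) / k ≤
      connProb p (1 - p) k (k - 1) := by
    rw [div_le_iff₀ hk', mul_comm _ (k : ℝ)]
    exact h
  have hexp : k * n = k * (n - k) + k ^ 2 := by
    rw [sq, ← mul_add, Nat.sub_add_cancel hkn]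
  calc _ = (n.choose k : ℝ) * ((1 - p) ^ (k * (n - k)) *
        ((k : ℝ) ^ (k - 1) * p ^ (k - 1) * (1 - p) ^ (k ^ 2) / k)) := by
        rw [hexp, pow_add]; unfold treeCount; ring
    _ ≤ _ := by unfold compExp; gcongr

/-- The total length of the minimum spanning tree, by integrating over levels. -/
def mstLength (u : Sym2 V → ℝ) : ℝ := ∫ p in (0 : ℝ)..1, ((numComp {e | u e ≤ p} : ℝ) - 1)

lemma intervalIntegrable_numComp (u : Sym2 V → ℝ) :
    IntervalIntegrable (fun p => (numComp {e | u e ≤ p} : ℝ) - 1) volume 0 1 := by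
  refine Antitone.intervalIntegrable fun p p' h => ?_
  have : numComp {e | u e ≤ p'} ≤ numComp {e | u e ≤ p} :=
    numComp_mono fun e he => le_trans he h
  have : (numComp {e | u e ≤ p'} : ℝ) ≤ numComp {e | u e ≤ p} := by exact_mod_cast this
  simpa using this

lemma intervalIntegrable_card_above (T : Finset (Sym2 V)) (u : Sym2 V → ℝ) :
    IntervalIntegrable (fun p => (#(T.filter fun e => p < u e) : ℝ)) volume 0 1 := by
  refine Antitone.intervalIntegrable fun p p' h => ?_
  have : #(T.filter fun e => p' < u e) ≤ #(T.filter fun e => p < u e) :=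
    Finset.card_le_card (Finset.monotone_filter_right T fun e _ he => lt_of_le_of_lt h he)
  exact_mod_cast this

lemma integral_ite_lt {a : ℝ} (ha : a ∈ Set.Icc (0 : ℝ) 1) :
    ∫ p in (0 : ℝ)..1, (if p < a then (1 : ℝ) else 0) = a := by
  rw [intervalIntegral.integral_of_le zero_le_one]
  have : (fun p : ℝ => if p < a then (1 : ℝ) else 0) = (Set.Iio a).indicator fun _ => 1 := by
    ext p
    simp [Set.indicator_apply]
  rw [this, setIntegral_indicator measurableSet_Iio, setIntegral_const, smul_eq_mul, mul_one,
    Measure.real]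
  have h : Set.Ioc (0 : ℝ) 1 ∩ Set.Iio a = Set.Ioo 0 a := by
    ext x
    simp only [Set.mem_inter_iff, Set.mem_Ioc, Set.mem_Iio, Set.mem_Ioo]
    exact ⟨fun h => ⟨h.1.1, h.2⟩, fun h => ⟨⟨h.1, h.2.le.trans ha.2⟩, h.2⟩⟩
  rw [h, Real.volume_Ioo, sub_zero, ENNReal.toReal_ofReal ha.1]

lemma sum_eq_integral_card_above (T : Finset (Sym2 V)) {u : Sym2 V → ℝ}
    (hu : ∀ e, u e ∈ Set.Icc (0 : ℝ) 1) :
    ∑ e ∈ T, u e = ∫ p in (0 : ℝ)..1, (#(T.filter fun e => p < u e) : ℝ) := by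
  have h : ∀ p : ℝ, (#(T.filter fun e => p < u e) : ℝ) =
      ∑ e ∈ T, if p < u e then (1 : ℝ) else 0 := by
    intro p
    rw [Finset.card_filter]
    push_cast
    rfl
  simp_rw [h]
  rw [intervalIntegral.integral_finsetSum]
  · exact Finset.sum_congr rfl fun e _ => (integral_ite_lt (hu e)).symm
  · intro e _
    refine Antitone.intervalIntegrable fun p p' h => ?_
    split_ifs <;> linarith

lemma mstLength_le_sum {T : Finset (Sym2 V)} (hT : T ∈ spanningTrees (⊤ : SimpleGraph V))
    {u : Sym2 V → ℝ} (hu : ∀ e, u e ∈ Set.Icc (0 : ℝ) 1) : mstLength u ≤ ∑ e ∈ T, u e := by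
  rw [sum_eq_integral_card_above T hu]
  refine intervalIntegral.integral_mono_on zero_le_one (intervalIntegrable_numComp u)
    (intervalIntegrable_card_above T u) fun p _ => ?_
  have := numComp_le_card_above hT u p
  have : (numComp {e | u e ≤ p} : ℝ) ≤ #(T.filter fun e => p < u e) + 1 := by exact_mod_cast this
  linarith

lemma exists_sum_eq_mstLength [Nonempty V] {u : Sym2 V → ℝ}
    (hu : ∀ e, u e ∈ Set.Icc (0 : ℝ) 1) :
    ∃ T ∈ spanningTrees (⊤ : SimpleGraph V), ∑ e ∈ T, u e = mstLength u := by
  obtain ⟨T, hT, h⟩ := exists_mst u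
  refine ⟨T, hT, ?_⟩
  rw [sum_eq_integral_card_above T hu, mstLength]
  congr 1
  ext p
  rw [← h p]
  push_cast
  ring

/-- A Gibbs average exceeds the minimal energy by at most `log N / β`. -/
lemma gibbs_average_le {α : Type*} {s : Finset α} {L : α → ℝ} {β N : ℝ} (hβ : 0 < β)
    (hN : (#s : ℝ) ≤ N) {t : α} (ht : t ∈ s) :
    (∑ a ∈ s, Real.exp (-β * L a) * L a) / ∑ a ∈ s, Real.exp (-β * L a) ≤
      L t + Real.log N / β := by
  have hN0 : 0 < N := lt_of_lt_of_le (by exact_mod_cast Finset.card_pos.2 ⟨t, ht⟩) hN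
  have hZ : 0 < ∑ a ∈ s, Real.exp (-β * L a) :=
    Finset.sum_pos (fun a _ => Real.exp_pos _) ⟨t, ht⟩
  rw [div_le_iff₀ hZ]
  have hpt : ∀ a ∈ s, Real.exp (-β * L a) * (β * (L a - L t) - Real.log N + 1) ≤
      Real.exp (-β * L t) / N := by
    intro a _
    have h1 := Real.add_one_le_exp (β * (L a - L t) - Real.log N)
    calc _ ≤ Real.exp (-β * L a) * Real.exp (β * (L a - L t) - Real.log N) := by gcongr
      _ = Real.exp (-β * L t) / N := by
        rw [← Real.exp_add, ← Real.exp_log hN0, ← Real.exp_sub, Real.log_exp]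
        congr 1
        ring
  have hsum := Finset.sum_le_sum hpt
  rw [Finset.sum_const, nsmul_eq_mul] at hsum
  have hle : (#s : ℝ) * (Real.exp (-β * L t) / N) ≤ ∑ a ∈ s, Real.exp (-β * L a) := by
    calc _ ≤ N * (Real.exp (-β * L t) / N) := by gcongr
      _ = Real.exp (-β * L t) := by field_simp
      _ ≤ _ := Finset.single_le_sum (f := fun a => Real.exp (-β * L a))
        (fun a _ => (Real.exp_pos _).le) ht
  have hexpand : ∑ a ∈ s, Real.exp (-β * L a) * (β * (L a - L t) - Real.log N + 1) =
      β * ∑ a ∈ s, Real.exp (-β * L a) * L a -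
        (β * L t + Real.log N - 1) * ∑ a ∈ s, Real.exp (-β * L a) := by
    rw [Finset.mul_sum, Finset.mul_sum, ← Finset.sum_sub_distrib]
    refine Finset.sum_congr rfl fun a _ => ?_
    ring
  rw [hexpand] at hsum
  have : β * ∑ a ∈ s, Real.exp (-β * L a) * L a ≤
      β * ((L t + Real.log N / β) * ∑ a ∈ s, Real.exp (-β * L a)) := by
    have : β * ((L t + Real.log N / β) * ∑ a ∈ s, Real.exp (-β * L a)) =
        (β * L t + Real.log N) * ∑ a ∈ s, Real.exp (-β * L a) := by
      field_simp
    rw [this]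
    linarith
  exact le_of_mul_le_mul_left this hβ

lemma le_gibbs_average {α : Type*} {s : Finset α} {L : α → ℝ} {β M : ℝ}
    (hM : ∀ a ∈ s, M ≤ L a) (hs : s.Nonempty) :
    M ≤ (∑ a ∈ s, Real.exp (-β * L a) * L a) / ∑ a ∈ s, Real.exp (-β * L a) := by
  rw [le_div_iff₀ (Finset.sum_pos (fun a _ => Real.exp_pos _) hs), Finset.mul_sum]
  refine Finset.sum_le_sum fun a ha => ?_
  rw [mul_comm]
  exact mul_le_mul_of_nonneg_left (hM a ha) (Real.exp_pos _).le

lemma treeWeight_exp (β : ℝ) (u : Sym2 V → ℝ) (T : Finset (Sym2 V)) :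
    treeWeight (fun e => Real.exp (-β * u e)) T = Real.exp (-β * ∑ e ∈ T, u e) := by
  rw [treeWeight, ← Real.exp_sum, Finset.mul_sum]

lemma card_spanningTrees_le (n : ℕ) (hn : 1 ≤ n) :
    #(spanningTrees (⊤ : SimpleGraph (Fin n))) ≤ (n ^ 2) ^ n := by
  classical
  have hcard : Fintype.card (Sym2 (Fin n)) ≤ n ^ 2 := by
    have := Fintype.card_le_of_surjective (fun z : Fin n × Fin n => s(z.1, z.2))
      (fun e => by induction e using Sym2.ind with | _ x y => exact ⟨(x, y), rfl⟩)
    simpa [sq] using this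
  have hsub : spanningTrees (⊤ : SimpleGraph (Fin n)) ⊆
      Finset.powersetCard (n - 1) Finset.univ := by
    intro T hT
    obtain ⟨-, hTG, htree⟩ := Finset.mem_filter.1 hT
    have he : (SimpleGraph.fromEdgeSet (T : Set (Sym2 (Fin n)))).edgeFinset = T := by
      ext e
      rw [SimpleGraph.mem_edgeFinset, SimpleGraph.edgeSet_fromEdgeSet]
      constructor
      · exact fun h => h.1
      · intro h
        have := hTG h
        rw [SimpleGraph.edgeSet_top] at this
        exact ⟨h, this⟩
    have := htree.card_edgeFinset
    rw [he, Fintype.card_fin] at this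
    exact Finset.mem_powersetCard.2 ⟨Finset.subset_univ _, by omega⟩
  calc _ ≤ (Fintype.card (Sym2 (Fin n))).choose (n - 1) := by
        simpa using Finset.card_le_card hsub
    _ ≤ (Fintype.card (Sym2 (Fin n))) ^ (n - 1) := Nat.choose_le_pow _ _
    _ ≤ (n ^ 2) ^ (n - 1) := Nat.pow_le_pow_left hcard _
    _ ≤ (n ^ 2) ^ n := Nat.pow_le_pow_right (by positivity) (by omega)

lemma measurable_numComp_prod :
    Measurable fun z : (Sym2 V → ℝ) × ℝ => (numComp {e | z.1 e ≤ z.2} : ℝ) := by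
  have : Measurable fun z : (Sym2 V → ℝ) × ℝ => numComp {e | z.1 e ≤ z.2} :=
    measurable_to_countable' fun k => measurableSet_sublevel_prod fun S => numComp S = k
  exact measurable_from_top.comp this

lemma numComp_le_card (S : Set (Sym2 V)) : numComp S ≤ Fintype.card V := by
  rw [← Nat.card_eq_fintype_card]
  exact Nat.card_le_card_of_surjective _ Quot.mk_surjective

lemma integrable_numComp_prod :
    Integrable (fun z : (Sym2 V → ℝ) × ℝ => (numComp {e | z.1 e ≤ z.2} : ℝ) - 1)
      ((labelMeasure (Sym2 V)).prod (volume.restrict (Set.Ioc (0 : ℝ) 1))) := by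
  refine Integrable.sub ?_ (integrable_const _)
  refine Integrable.of_bound measurable_numComp_prod.aestronglyMeasurable (Fintype.card V)
    (ae_of_all _ fun z => ?_)
  rw [Real.norm_of_nonneg (by positivity)]
  exact_mod_cast numComp_le_card _

lemma integrable_mstLength : Integrable (mstLength (V := V)) (labelMeasure (Sym2 V)) := by
  have := (integrable_numComp_prod (V := V)).integral_prod_left
  refine this.congr (ae_of_all _ fun u => ?_)
  simp only [mstLength, intervalIntegral.integral_of_le zero_le_one]

lemma integral_mstLength :
    ∫ u, mstLength u ∂labelMeasure (Sym2 V) =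
      ∫ p in (0 : ℝ)..1,
        (∑ k ∈ Finset.Icc 1 (Fintype.card V), compExp (Fintype.card V) k p - 1) := by
  simp only [mstLength, intervalIntegral.integral_of_le zero_le_one]
  rw [integral_integral_swap integrable_numComp_prod]
  refine setIntegral_congr_fun measurableSet_Ioc fun p hp => ?_
  have hp' : p ∈ Set.Icc (0 : ℝ) 1 := Set.Ioc_subset_Icc_self hp
  rw [← integral_numComp hp', integral_sub _ (integrable_const _)]
  · simp
  · refine Integrable.of_bound (measurable_numComp_prod.comp
      (measurable_id.prodMk measurable_const)).aestronglyMeasurable (Fintype.card V)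
      (ae_of_all _ fun z => ?_)
    rw [Real.norm_of_nonneg (by positivity)]
    exact_mod_cast numComp_le_card _

lemma ae_labelMeasure_mem (ι : Type) [Fintype ι] :
    ∀ᵐ u ∂labelMeasure ι, ∀ e, u e ∈ Set.Icc (0 : ℝ) 1 := by
  rw [ae_all_iff]
  intro e
  have := (Measure.quasiMeasurePreserving_eval
    (fun _ : ι => volume.restrict (Set.Icc (0 : ℝ) 1)) e).ae
    (ae_restrict_mem measurableSet_Icc)
  exact this

/-- The weighted spanning tree is on average longer than the minimum spanning tree by at most
the entropy term `log ((n ^ 2) ^ n) / β`. -/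
lemma expLengthK_bounds (n : ℕ) (hn : 1 ≤ n) {β : ℝ} (hβ : 0 < β) :
    ∫ u, mstLength u ∂labelMeasure (Sym2 (Fin n)) ≤ expLengthK n β ∧
      expLengthK n β ≤ ∫ u, mstLength u ∂labelMeasure (Sym2 (Fin n)) +
        2 * (n * Real.log n / β) := by
  have : Nonempty (Fin n) := ⟨⟨0, hn⟩⟩
  set F : (Sym2 (Fin n) → ℝ) → ℝ := fun u =>
    (∑ T ∈ spanningTrees (⊤ : SimpleGraph (Fin n)),
        Real.exp (-β * ∑ e ∈ T, u e) * (∑ e ∈ T, u e)) /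
      ∑ T ∈ spanningTrees (⊤ : SimpleGraph (Fin n)), Real.exp (-β * ∑ e ∈ T, u e) with hF
  have hexp : expLengthK n β = ∫ u, F u ∂labelMeasure (Sym2 (Fin n)) := by
    simp only [expLengthK, partZ, treeWeight_exp, hF]
  have hcard : (#(spanningTrees (⊤ : SimpleGraph (Fin n))) : ℝ) ≤ ((n : ℝ) ^ 2) ^ n := by
    exact_mod_cast card_spanningTrees_le n hn
  have hlog : Real.log (((n : ℝ) ^ 2) ^ n) / β = 2 * (n * Real.log n / β) := by
    rw [Real.log_pow, Real.log_pow]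
    push_cast
    ring
  have hlow : ∀ᵐ u ∂labelMeasure (Sym2 (Fin n)), mstLength u ≤ F u := by
    filter_upwards [ae_labelMeasure_mem _] with u hu
    obtain ⟨T, hT, -⟩ := exists_sum_eq_mstLength hu
    exact le_gibbs_average (L := fun T => ∑ e ∈ T, u e)
      (fun T hT => mstLength_le_sum hT hu) ⟨T, hT⟩
  have hup : ∀ᵐ u ∂labelMeasure (Sym2 (Fin n)),
      F u ≤ mstLength u + 2 * (n * Real.log n / β) := by
    filter_upwards [ae_labelMeasure_mem _] with u hu
    obtain ⟨T, hT, hLT⟩ := exists_sum_eq_mstLength hu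
    have := gibbs_average_le (L := fun T => ∑ e ∈ T, u e) hβ hcard hT
    rwa [hlog, hLT] at this
  have hmean : Integrable (fun u => mstLength u + 2 * (n * Real.log n / β))
      (labelMeasure (Sym2 (Fin n))) := integrable_mstLength.add (integrable_const _)
  have hFm : AEStronglyMeasurable F (labelMeasure (Sym2 (Fin n))) := by
    have : Measurable F := by
      simp only [hF]
      fun_prop
    exact this.aestronglyMeasurable
  have hFint : Integrable F (labelMeasure (Sym2 (Fin n))) :=
    integrable_of_le_of_le hFm hlow hup integrable_mstLength hmean
  rw [hexp]
  refine ⟨integral_mono_ae integrable_mstLength hFint hlow, ?_⟩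
  refine (integral_mono_ae hFint hmean hup).trans (le_of_eq ?_)
  rw [integral_add integrable_mstLength (integrable_const _)]
  simp

open Nat in
lemma integral_pow_mul_one_sub_pow (a b : ℕ) :
    ∫ p in (0 : ℝ)..1, p ^ a * (1 - p) ^ b = a ! * b ! / (a + b + 1)! := by
  induction b generalizing a with
  | zero =>
    simp only [pow_zero, mul_one, integral_pow, one_pow, Nat.factorial_zero, Nat.cast_one,
      add_zero, Nat.factorial_succ]
    push_cast
    have : (a ! : ℝ) ≠ 0 := by positivity
    field_simp
    simp
  | succ b ih =>
    have hv : ∀ p ∈ Set.uIcc (0 : ℝ) 1,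
        HasDerivAt (fun p : ℝ => p ^ (a + 1) / (a + 1)) (p ^ a) p := fun p _ => by
      have h := (hasDerivAt_pow (a + 1) p).div_const ((a : ℝ) + 1)
      have ha : (a : ℝ) + 1 ≠ 0 := by positivity
      refine h.congr_deriv ?_
      rw [Nat.add_sub_cancel]
      push_cast
      rw [mul_div_cancel_left₀ _ ha]
    have hu : ∀ p ∈ Set.uIcc (0 : ℝ) 1,
        HasDerivAt (fun p : ℝ => (1 - p) ^ (b + 1)) (-((b + 1) * (1 - p) ^ b)) p := fun p _ => by
      have h := ((hasDerivAt_id p).const_sub 1).pow (b + 1)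
      refine h.congr_deriv ?_
      simp
    have h := intervalIntegral.integral_mul_deriv_eq_deriv_mul hu hv
      (Continuous.intervalIntegrable (by fun_prop) _ _)
      (Continuous.intervalIntegrable (by fun_prop) _ _)
    have hcongr : ∀ p : ℝ, p ^ a * (1 - p) ^ (b + 1) = (1 - p) ^ (b + 1) * p ^ a :=
      fun p => mul_comm _ _
    have hrw : ∀ p : ℝ, -((b + 1) * (1 - p) ^ b) * (p ^ (a + 1) / (a + 1)) =
        -((b + 1) / (a + 1)) * (p ^ (a + 1) * (1 - p) ^ b) := fun p => by ring
    simp only [hcongr, h, hrw, intervalIntegral.integral_const_mul, ih]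
    have e : a + (b + 1) + 1 = a + 1 + b + 1 := by ring
    rw [e, Nat.factorial_succ a, Nat.factorial_succ b]
    push_cast
    have : (a : ℝ) + 1 ≠ 0 := by positivity
    have : ((a + 1 + b + 1)! : ℝ) ≠ 0 := by positivity
    field_simp
    simp

open Nat in
lemma treeCount_mul_integral {n k : ℕ} (hk : 1 ≤ k) (M : ℕ) :
    treeCount n k * ∫ p in (0 : ℝ)..1, p ^ (k - 1) * (1 - p) ^ M =
      (k : ℝ) ^ k * n.descFactorial k / (M + 1).ascFactorial k / k ^ 3 := by
  obtain ⟨j, rfl⟩ : ∃ j, k = j + 1 := ⟨k - 1, by omega⟩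
  have e : j + M + 1 = M + (j + 1) := by ring
  rw [integral_pow_mul_one_sub_pow, treeCount, Nat.descFactorial_eq_factorial_mul_choose,
    Nat.add_sub_cancel, e, ← Nat.factorial_mul_ascFactorial M (j + 1), Nat.factorial_succ j]
  push_cast
  have : (M ! : ℝ) ≠ 0 := by positivity
  have : (j : ℝ) + 1 ≠ 0 := by positivity
  have : ((M + 1).ascFactorial (j + 1) : ℝ) ≠ 0 := by
    have := Nat.ascFactorial_pos (M + 1) (j + 1)
    positivity
  field_simp
  ring

lemma treeCount_mul_integral_le {n k : ℕ} (hk : 1 ≤ k) (hkn : k < n) :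
    treeCount n k * ∫ p in (0 : ℝ)..1, p ^ (k - 1) * (1 - p) ^ (k * (n - k)) ≤
      ((n : ℝ) / (n - k)) ^ k / k ^ 3 := by
  rw [treeCount_mul_integral hk]
  have hk' : (0 : ℝ) < k := by exact_mod_cast hk
  have hkn' : (0 : ℝ) < n - k := by
    rw [sub_pos]
    exact_mod_cast hkn
  have h1 : (n.descFactorial k : ℝ) ≤ (n : ℝ) ^ k := by exact_mod_cast Nat.descFactorial_le_pow n k
  have h2 : ((k : ℝ) * (n - k)) ^ k ≤ ((k * (n - k) + 1).ascFactorial k : ℕ) := by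
    rw [← Nat.cast_sub hkn.le]
    have h := Nat.pow_succ_le_ascFactorial (k * (n - k) + 1) k
    have h' : (k * (n - k)) ^ k ≤ (k * (n - k) + 1) ^ k := Nat.pow_le_pow_left (by omega) _
    exact_mod_cast h'.trans h
  have h3 : ((n : ℝ) / (n - k)) ^ k = (k : ℝ) ^ k * n ^ k / (k * (n - k)) ^ k := by
    rw [div_pow, mul_pow]
    field_simp
  rw [h3]
  gcongr

lemma le_treeCount_mul_integral {n k : ℕ} (hk : 1 ≤ k) (hkn : k ≤ n) :
    (((n : ℝ) - k) / (n + 1)) ^ k / k ^ 3 ≤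
      treeCount n k * ∫ p in (0 : ℝ)..1, p ^ (k - 1) * (1 - p) ^ (k * n) := by
  rw [treeCount_mul_integral hk]
  have hk' : (0 : ℝ) < k := by exact_mod_cast hk
  have hkn' : (0 : ℝ) ≤ n - k := by
    rw [sub_nonneg]
    exact_mod_cast hkn
  have h1 : ((n : ℝ) - k) ^ k ≤ n.descFactorial k := by
    rw [← Nat.cast_sub hkn]
    have h := Nat.pow_sub_le_descFactorial n k
    have h' : (n - k) ^ k ≤ (n + 1 - k) ^ k := Nat.pow_le_pow_left (by omega) _
    exact_mod_cast h'.trans h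
  have h2 : ((k * n + 1).ascFactorial k : ℝ) ≤ ((k : ℝ) * (n + 1)) ^ k := by
    have h := Nat.ascFactorial_le_pow_add (k * n) k
    rw [mul_add, mul_one]
    exact_mod_cast h
  have h0 : (0 : ℝ) < ((k * n + 1).ascFactorial k : ℕ) := by
    exact_mod_cast Nat.ascFactorial_pos _ _
  have h3 : (((n : ℝ) - k) / (n + 1)) ^ k = (k : ℝ) ^ k * (n - k) ^ k / (k * (n + 1)) ^ k := by
    rw [div_pow, mul_pow]
    field_simp
  rw [h3]
  gcongr

lemma sum_compExp_sub_one_eq {p : ℝ} (hp : p ∈ Set.Icc (0 : ℝ) 1) {n : ℕ} (hn : 1 ≤ n) :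
    ∑ k ∈ Finset.Icc 1 n, compExp n k p - 1 =
      ∑ k ∈ Finset.Icc 1 n, (1 - (k : ℝ) / n) * compExp n k p := by
  have hn' : (n : ℝ) ≠ 0 := by positivity
  have h : ∑ k ∈ Finset.Icc 1 n, (k : ℝ) / n * compExp n k p = 1 := by
    rw [← div_self hn']
    nth_rewrite 2 [← sum_mul_compExp hp n]
    rw [Finset.sum_div]
    exact Finset.sum_congr rfl fun k _ => by ring
  simp only [sub_mul, one_mul, Finset.sum_sub_distrib, h]

lemma le_sum_compExp_sub_one {p : ℝ} (hp : p ∈ Set.Icc (0 : ℝ) 1) {n K : ℕ} (hn : 1 ≤ n)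
    (hK : K ≤ n) :
    ∑ k ∈ Finset.Icc 1 K, (1 - (k : ℝ) / n) *
        (treeCount n k * (p ^ (k - 1) * (1 - p) ^ (k * n))) ≤
      ∑ k ∈ Finset.Icc 1 n, compExp n k p - 1 := by
  rw [sum_compExp_sub_one_eq hp hn]
  have hc : ∀ k ∈ Finset.Icc 1 n, 0 ≤ 1 - (k : ℝ) / n := fun k hk => by
    rw [sub_nonneg]
    exact div_le_one_of_le₀ (by exact_mod_cast (Finset.mem_Icc.1 hk).2) (by positivity)
  have hsub : Finset.Icc 1 K ⊆ Finset.Icc 1 n := Finset.Icc_subset_Icc_right hK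
  refine (Finset.sum_le_sum fun k hk => ?_).trans
    (Finset.sum_le_sum_of_subset_of_nonneg hsub fun k hk _ =>
      mul_nonneg (hc k hk) (compExp_nonneg hp n k))
  have hk' := Finset.mem_Icc.1 (hsub hk)
  exact mul_le_mul_of_nonneg_left (compExp_lower hp hk'.1 hk'.2) (hc k (hsub hk))

lemma mul_exp_le_one {x : ℝ} (hx : 32 ≤ x) : x * Real.exp (1 - x / 4) ≤ 1 := by
  have h := Real.quadratic_le_exp_of_nonneg (x := x / 4 - 1) (by linarith)
  have h2 : x ≤ Real.exp (x / 4 - 1) := by nlinarith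
  rw [show 1 - x / 4 = -(x / 4 - 1) by ring, Real.exp_neg, ← div_eq_mul_inv]
  exact div_le_one_of_le₀ h2 (Real.exp_pos _).le

lemma treeCount_le {n k : ℕ} : treeCount n k ≤ n ^ k * Real.exp k / k ^ 2 := by
  rcases Nat.eq_zero_or_pos k with rfl | hk
  · simp [treeCount]
  have hk' : (0 : ℝ) < k := by exact_mod_cast hk
  have h1 : (n.choose k : ℝ) ≤ (n : ℝ) ^ k / k.factorial := Nat.choose_le_pow_div k n
  have h2 := Real.pow_div_factorial_le_exp (k : ℝ) hk'.le k
  obtain ⟨j, rfl⟩ : ∃ j, k = j + 1 := ⟨k - 1, by omega⟩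
  calc treeCount n (j + 1) ≤ (n : ℝ) ^ (j + 1) / (j + 1).factorial *
        (((j + 1 : ℕ) : ℝ) ^ (j + 1 - 1) / (j + 1 : ℕ)) := by unfold treeCount; gcongr
    _ = (n : ℝ) ^ (j + 1) * (((j + 1 : ℕ) : ℝ) ^ (j + 1) / (j + 1).factorial) /
        ((j + 1 : ℕ) : ℝ) ^ 2 := by
      rw [Nat.add_sub_cancel]
      field_simp
      ring
    _ ≤ _ := by gcongr

lemma treeCount_mul_le {p : ℝ} (hp : p ∈ Set.Icc (0 : ℝ) 1) {n k : ℕ} (hk : 1 ≤ k)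
    (hkn : 2 * k ≤ n) (hx : 32 ≤ n * p) :
    treeCount n k * (p ^ (k - 1) * (1 - p) ^ (k * (n - k))) ≤
      n * Real.exp (-(n * p / 4)) * ((k : ℝ) ^ 2)⁻¹ := by
  have hk' : (1 : ℝ) ≤ k := by exact_mod_cast hk
  have hn' : (0 : ℝ) ≤ n := by positivity
  have hq := sub_nonneg.2 hp.2
  have hknr : (2 : ℝ) * k ≤ n := by exact_mod_cast hkn
  have h1 : (1 - p) ^ (k * (n - k)) ≤ Real.exp (-(k * (n * p / 2))) := by
    calc (1 - p) ^ (k * (n - k)) ≤ Real.exp (-p) ^ (k * (n - k)) := by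
          gcongr
          linarith [Real.add_one_le_exp (-p)]
      _ = Real.exp (-(k * ((n - k) * p))) := by
          rw [← Real.exp_nat_mul, Nat.cast_mul, Nat.cast_sub (by omega)]
          ring_nf
      _ ≤ _ := by
          refine Real.exp_le_exp.2 (neg_le_neg ?_)
          have := hp.1
          have : (n : ℝ) * p / 2 ≤ (n - k) * p := by nlinarith
          gcongr
  have hxk : (n : ℝ) ^ k * p ^ (k - 1) ≤ n * (n * p) ^ k := by
    have e : (n : ℝ) ^ k * p ^ (k - 1) = n * (n * p) ^ (k - 1) := by
      rw [mul_pow, ← mul_assoc, ← pow_succ', Nat.sub_add_cancel hk]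
    rw [e]
    gcongr
    · linarith
    · omega
  have h3 : (n * p) ^ k * Real.exp k * Real.exp (-(k * (n * p / 2))) ≤
      Real.exp (-(n * p / 4)) := by
    have e : (n * p) ^ k * Real.exp k * Real.exp (-(k * (n * p / 2))) =
        (n * p * Real.exp (1 - n * p / 4)) ^ k * Real.exp (-(k * (n * p / 4))) := by
      rw [mul_pow _ (Real.exp _), ← Real.exp_nat_mul, mul_assoc, mul_assoc,
        ← Real.exp_add, ← Real.exp_add]
      ring_nf
    rw [e]
    have hpos : 0 ≤ n * p * Real.exp (1 - n * p / 4) := by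
      have := Real.exp_pos (1 - n * p / 4)
      have : 0 ≤ n * p := by linarith
      positivity
    calc _ ≤ 1 * Real.exp (-(k * (n * p / 4))) := by
          gcongr
          exact pow_le_one₀ hpos (mul_exp_le_one hx)
      _ ≤ _ := by
          rw [one_mul]
          refine Real.exp_le_exp.2 ?_
          nlinarith
  have hpk : 0 ≤ p ^ (k - 1) := pow_nonneg hp.1 _
  calc treeCount n k * (p ^ (k - 1) * (1 - p) ^ (k * (n - k)))
      ≤ (n ^ k * Real.exp k / k ^ 2) * (p ^ (k - 1) * Real.exp (-(k * (n * p / 2)))) := by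
        gcongr
        exact treeCount_le
    _ = (n ^ k * p ^ (k - 1)) * (Real.exp k * Real.exp (-(k * (n * p / 2)))) *
        ((k : ℝ) ^ 2)⁻¹ := by
        ring
    _ ≤ (n * (n * p) ^ k) * (Real.exp k * Real.exp (-(k * (n * p / 2)))) *
        ((k : ℝ) ^ 2)⁻¹ := by gcongr
    _ = n * ((n * p) ^ k * Real.exp k * Real.exp (-(k * (n * p / 2)))) *
        ((k : ℝ) ^ 2)⁻¹ := by ring
    _ ≤ _ := by gcongr

lemma sum_compExp_sub_one_le {p : ℝ} (hp : p ∈ Set.Icc (0 : ℝ) 1) (n : ℕ) {K : ℕ} (hK : 1 ≤ K) :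
    ∑ k ∈ Finset.Icc 1 n, compExp n k p - 1 ≤
      ∑ k ∈ Finset.Icc 1 K, treeCount n k * (p ^ (k - 1) * (1 - p) ^ (k * (n - k))) +
        Real.exp 8 / K * (n * Real.exp (-(n * p / 4))) := by
  have hK' : (0 : ℝ) < K := by exact_mod_cast hK
  have hq := sub_nonneg.2 hp.2
  have hsmall : ∀ s ⊆ Finset.Icc 1 n, ∑ k ∈ s with k ≤ K, compExp n k p ≤
      ∑ k ∈ Finset.Icc 1 K, treeCount n k * (p ^ (k - 1) * (1 - p) ^ (k * (n - k))) := by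
    intro s hs
    have hsub : s.filter (· ≤ K) ⊆ Finset.Icc 1 K := fun k hk => by
      have h := Finset.mem_filter.1 hk
      exact Finset.mem_Icc.2 ⟨(Finset.mem_Icc.1 (hs h.1)).1, h.2⟩
    refine (Finset.sum_le_sum fun k hk =>
      compExp_upper hp n (Finset.mem_Icc.1 (hsub hk)).1).trans
      (Finset.sum_le_sum_of_subset_of_nonneg hsub fun k _ _ => ?_)
    have := treeCount_nonneg n k
    have := hp.1
    positivity
  rcases le_or_gt 32 (n * p) with hx | hx
  · have hlarge := sum_large_compExp_le_one hp n
    rw [← Finset.sum_filter_add_sum_filter_not (Finset.Icc 1 n) (fun k => n < 2 * k)]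
    set s := (Finset.Icc 1 n).filter (fun k => ¬ n < 2 * k) with hs
    have hss : s ⊆ Finset.Icc 1 n := Finset.filter_subset _ _
    rw [← Finset.sum_filter_add_sum_filter_not s (fun k => k ≤ K)]
    have h1 := hsmall s hss
    have h2 : ∑ k ∈ s with ¬ k ≤ K, compExp n k p ≤
        Real.exp 8 / K * (n * Real.exp (-(n * p / 4))) := by
      have hsub : s.filter (fun k => ¬ k ≤ K) ⊆ Finset.Ioc K (max K n) := fun k hk => by
        have h := Finset.mem_filter.1 hk
        have h' := Finset.mem_Icc.1 (hss h.1)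
        exact Finset.mem_Ioc.2 ⟨by omega, h'.2.trans (le_max_right _ _)⟩
      calc ∑ k ∈ s with ¬ k ≤ K, compExp n k p
          ≤ ∑ k ∈ s with ¬ k ≤ K, n * Real.exp (-(n * p / 4)) * ((k : ℝ) ^ 2)⁻¹ := by
            refine Finset.sum_le_sum fun k hk => ?_
            have h := (Finset.mem_filter.1 hk).1
            have hk1 := (Finset.mem_Icc.1 (hss h)).1
            have hk2 := (Finset.mem_filter.1 h).2
            exact (compExp_upper hp n hk1).trans (treeCount_mul_le hp hk1 (by omega) hx)
        _ ≤ ∑ k ∈ Finset.Ioc K (max K n), n * Real.exp (-(n * p / 4)) * ((k : ℝ) ^ 2)⁻¹ :=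
            Finset.sum_le_sum_of_subset_of_nonneg hsub fun k _ _ => by positivity
        _ = n * Real.exp (-(n * p / 4)) * ∑ k ∈ Finset.Ioc K (max K n), ((k : ℝ) ^ 2)⁻¹ := by
            rw [Finset.mul_sum]
        _ ≤ n * Real.exp (-(n * p / 4)) * (K : ℝ)⁻¹ := by
            gcongr
            have h := sum_Ioc_inv_sq_le_sub (α := ℝ) (by omega : K ≠ 0) (le_max_left K n)
            refine h.trans (sub_le_self _ (by positivity))
        _ ≤ n * Real.exp (-(n * p / 4)) * (Real.exp 8 * (K : ℝ)⁻¹) := by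
            gcongr
            exact le_mul_of_one_le_left (by positivity) (Real.one_le_exp (by norm_num))
        _ = _ := by ring
    linarith
  · rw [← Finset.sum_filter_add_sum_filter_not (Finset.Icc 1 n) (fun k => k ≤ K)]
    have h1 := hsmall _ (Finset.Subset.refl (Finset.Icc 1 n))
    have h2 : K * ∑ k ∈ Finset.Icc 1 n with ¬ k ≤ K, compExp n k p ≤ n := by
      rw [← sum_mul_compExp hp n, Finset.mul_sum]
      refine (Finset.sum_le_sum fun k hk => ?_).trans
        (Finset.sum_le_sum_of_subset_of_nonneg (Finset.filter_subset _ _) fun k _ _ =>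
          mul_nonneg (by positivity) (compExp_nonneg hp n k))
      have h := (Finset.mem_filter.1 hk).2
      have hKk : (K : ℝ) ≤ k := by exact_mod_cast (not_le.1 h).le
      exact mul_le_mul_of_nonneg_right hKk (compExp_nonneg hp n k)
    have h3 : (1 : ℝ) ≤ Real.exp 8 * Real.exp (-(n * p / 4)) := by
      rw [← Real.exp_add]
      exact Real.one_le_exp (by linarith)
    have h4 : (n : ℝ) / K ≤ Real.exp 8 / K * (n * Real.exp (-(n * p / 4))) := by
      calc (n : ℝ) / K = n / K * 1 := by ring
        _ ≤ n / K * (Real.exp 8 * Real.exp (-(n * p / 4))) := by gcongr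
        _ = _ := by ring
    have h5 : ∑ k ∈ Finset.Icc 1 n with ¬ k ≤ K, compExp n k p ≤ n / K := by
      rw [le_div_iff₀ hK', mul_comm]
      exact h2
    linarith

lemma integral_mul_exp_le (n : ℕ) :
    ∫ p in (0 : ℝ)..1, n * Real.exp (-(n * p / 4)) ≤ 4 := by
  have h : ∀ p ∈ Set.uIcc (0 : ℝ) 1,
      HasDerivAt (fun p : ℝ => -4 * Real.exp (-(n * p / 4))) (n * Real.exp (-(n * p / 4))) p := by
    intro p _
    have h1 : HasDerivAt (fun p : ℝ => -(n * p / 4)) (-(n * 1 / 4)) p :=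
      (((hasDerivAt_id p).const_mul (n : ℝ)).div_const 4).neg
    refine (h1.exp.const_mul (-4)).congr_deriv ?_
    ring
  rw [intervalIntegral.integral_eq_sub_of_hasDerivAt h
    (Continuous.intervalIntegrable (by fun_prop) _ _)]
  have := Real.exp_pos (-((n : ℝ) * 1 / 4))
  simp only [mul_zero, zero_div, neg_zero, Real.exp_zero]
  linarith

lemma continuous_sum_compExp_sub_one (n : ℕ) :
    Continuous fun p => ∑ k ∈ Finset.Icc 1 n, compExp n k p - 1 :=
  (continuous_finsetSum _ fun k _ => continuous_compExp n k).sub continuous_const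

lemma le_integral_sum_compExp {n K : ℕ} (hn : 1 ≤ n) (hK : K ≤ n) :
    ∑ k ∈ Finset.Icc 1 K, (1 - (k : ℝ) / n) * ((((n : ℝ) - k) / (n + 1)) ^ k / k ^ 3) ≤
      ∫ p in (0 : ℝ)..1, (∑ k ∈ Finset.Icc 1 n, compExp n k p - 1) := by
  have hmono := intervalIntegral.integral_mono_on (μ := volume) zero_le_one
    (Continuous.intervalIntegrable (by fun_prop) _ _)
    ((continuous_sum_compExp_sub_one n).intervalIntegrable _ _)
    fun p hp => le_sum_compExp_sub_one hp hn hK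
  refine le_trans ?_ hmono
  rw [intervalIntegral.integral_finsetSum
    fun k _ => Continuous.intervalIntegrable (by fun_prop) _ _]
  refine Finset.sum_le_sum fun k hk => ?_
  simp only [intervalIntegral.integral_const_mul]
  obtain ⟨hk1, hk2⟩ := Finset.mem_Icc.1 hk
  refine mul_le_mul_of_nonneg_left (le_treeCount_mul_integral hk1 (hk2.trans hK)) ?_
  rw [sub_nonneg]
  exact div_le_one_of_le₀ (by exact_mod_cast hk2.trans hK) (by positivity)

lemma integral_sum_compExp_le {n K : ℕ} (hK : 1 ≤ K) (hKn : K < n) :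
    ∫ p in (0 : ℝ)..1, (∑ k ∈ Finset.Icc 1 n, compExp n k p - 1) ≤
      ∑ k ∈ Finset.Icc 1 K, ((n : ℝ) / (n - k)) ^ k / k ^ 3 + Real.exp 8 / K * 4 := by
  have hmono := intervalIntegral.integral_mono_on (μ := volume) zero_le_one
    ((continuous_sum_compExp_sub_one n).intervalIntegrable _ _)
    (Continuous.intervalIntegrable (by fun_prop) _ _)
    fun p hp => sum_compExp_sub_one_le hp n hK
  refine hmono.trans ?_
  rw [intervalIntegral.integral_add (Continuous.intervalIntegrable (by fun_prop) _ _)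
    (Continuous.intervalIntegrable (by fun_prop) _ _),
    intervalIntegral.integral_finsetSum
    fun k _ => Continuous.intervalIntegrable (by fun_prop) _ _]
  simp only [intervalIntegral.integral_const_mul _ (fun p : ℝ => _ ^ _ * _)]
  rw [intervalIntegral.integral_const_mul (Real.exp 8 / K)]
  refine add_le_add (Finset.sum_le_sum fun k hk => ?_)
    (mul_le_mul_of_nonneg_left (integral_mul_exp_le n) (by positivity))
  obtain ⟨hk1, hk2⟩ := Finset.mem_Icc.1 hk
  exact treeCount_mul_integral_le hk1 (hk2.trans_lt hKn)

lemma sum_Icc_inv_pow_three (K : ℕ) :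
    ∑ k ∈ Finset.Icc 1 K, 1 / (k : ℝ) ^ 3 = ∑ k ∈ Finset.range K, ((k : ℝ) + 1)⁻¹ ^ 3 := by
  induction K with
  | zero => simp
  | succ K ih =>
    rw [Finset.sum_Icc_succ_top (by omega), ih, Finset.sum_range_succ]
    push_cast
    rw [inv_pow, one_div]

lemma tendsto_sum_inv_pow_three :
    Tendsto (fun K : ℕ => ∑ k ∈ Finset.Icc 1 K, 1 / (k : ℝ) ^ 3) atTop (nhds zeta3) := by
  have hs : Summable fun k : ℕ => ((k : ℝ) + 1)⁻¹ ^ 3 := by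
    have h := (summable_nat_add_iff 1).2 (Real.summable_nat_pow_inv.2 (by norm_num : 1 < 3))
    simpa [inv_pow] using h
  simp only [sum_Icc_inv_pow_three]
  exact hs.hasSum.tendsto_sum_nat

lemma sum_inv_pow_three_le (K : ℕ) : ∑ k ∈ Finset.Icc 1 K, 1 / (k : ℝ) ^ 3 ≤ zeta3 := by
  refine (monotone_nat_of_le_succ fun K => ?_).ge_of_tendsto tendsto_sum_inv_pow_three K
  rw [Finset.sum_Icc_succ_top (by omega)]
  exact le_add_of_nonneg_right (by positivity)

lemma tendsto_sub_div_natCast (k c : ℝ) :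
    Tendsto (fun n : ℕ => ((n : ℝ) - k) / (n + c)) atTop (nhds 1) := by
  have h1 : Tendsto (fun n : ℕ => (1 - k / n) / (1 + c / n)) atTop (nhds ((1 - 0) / (1 + 0))) :=
    (tendsto_const_nhds.sub (tendsto_const_div_atTop_nhds_zero_nat k)).div
      (tendsto_const_nhds.add (tendsto_const_div_atTop_nhds_zero_nat c)) (by norm_num)
  rw [sub_zero, add_zero, div_one] at h1
  refine h1.congr' ?_
  filter_upwards [eventually_gt_atTop 0] with n hn
  have hn' : (n : ℝ) ≠ 0 := by positivity
  rw [← mul_div_mul_left (1 - k / n) (1 + c / n) hn']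
  congr 1 <;> field_simp

/-- Frieze's theorem for the integrated mean number of components. -/
lemma tendsto_integral_sum_compExp :
    Tendsto (fun n : ℕ => ∫ p in (0 : ℝ)..1, (∑ k ∈ Finset.Icc 1 n, compExp n k p - 1))
      atTop (nhds zeta3) := by
  refine tendsto_order.2 ⟨fun a ha => ?_, fun a ha => ?_⟩
  · obtain ⟨K, hK⟩ := (tendsto_sum_inv_pow_three.eventually (lt_mem_nhds ha)).exists
    have hlim : Tendsto (fun n : ℕ => ∑ k ∈ Finset.Icc 1 K,
        (1 - (k : ℝ) / n) * ((((n : ℝ) - k) / (n + 1)) ^ k / k ^ 3)) atTop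
        (nhds (∑ k ∈ Finset.Icc 1 K, (1 - 0) * ((1 : ℝ) ^ k / k ^ 3))) :=
      tendsto_finsetSum _ fun k _ =>
        (tendsto_const_nhds.sub (tendsto_const_div_atTop_nhds_zero_nat _)).mul
          (((tendsto_sub_div_natCast k 1).pow k).div_const _)
    simp only [sub_zero, one_mul, one_pow] at hlim
    filter_upwards [hlim.eventually (lt_mem_nhds hK), eventually_ge_atTop K,
      eventually_ge_atTop 1] with n hn hKn hn1
    exact hn.trans_le (le_integral_sum_compExp hn1 hKn)
  · have hK0 : Tendsto (fun K : ℕ => Real.exp 8 / K * 4) atTop (nhds (0 * 4)) :=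
      (tendsto_const_div_atTop_nhds_zero_nat _).mul_const 4
    rw [zero_mul] at hK0
    obtain ⟨K, hK, hK1⟩ := ((hK0.eventually (gt_mem_nhds (sub_pos.2 ha))).and
      (eventually_ge_atTop 1)).exists
    have hlim : Tendsto (fun n : ℕ => ∑ k ∈ Finset.Icc 1 K,
        ((n : ℝ) / (n - k)) ^ k / k ^ 3 + Real.exp 8 / K * 4) atTop
        (nhds (∑ k ∈ Finset.Icc 1 K, (1 : ℝ) ^ k / k ^ 3 + Real.exp 8 / K * 4)) :=
      (tendsto_finsetSum _ fun k _ => by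
        have h := tendsto_sub_div_natCast 0 (-k)
        simp only [sub_zero, ← sub_eq_add_neg] at h
        exact (h.pow k).div_const _).add_const _
    simp only [one_pow] at hlim
    have hlt : ∑ k ∈ Finset.Icc 1 K, 1 / (k : ℝ) ^ 3 + Real.exp 8 / K * 4 < a := by
      linarith [sum_inv_pow_three_le K]
    filter_upwards [hlim.eventually (gt_mem_nhds hlt), eventually_gt_atTop K] with n hn hKn
    exact (integral_sum_compExp_le hK1 hKn).trans_lt hn

/-- If `βₙ ≫ n·log n`, then `E[L(WST^{βₙ}(Kₙ))] → ζ(3)` as `n → ∞`. -/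
theorem expected_length_mst_phase (β : ℕ → ℝ)
    (hβ0 : ∀ n, 0 ≤ β n)
    (hβ : Tendsto (fun n : ℕ => β n / ((n : ℝ) * Real.log n)) atTop atTop) :
    Tendsto (fun n : ℕ => expLengthK n (β n)) atTop (nhds zeta3) := by
  have herr : Tendsto (fun n : ℕ => 2 * ((n : ℝ) * Real.log n / β n)) atTop (nhds (2 * 0)) := by
    have h := hβ.inv_tendsto_atTop
    simp only [Pi.inv_def, inv_div] at h
    exact h.const_mul 2
  have hmean : ∀ n : ℕ, ∫ u, mstLength u ∂labelMeasure (Sym2 (Fin n)) =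
      ∫ p in (0 : ℝ)..1, (∑ k ∈ Finset.Icc 1 n, compExp n k p - 1) := fun n => by
    have h := integral_mstLength (V := Fin n)
    rwa [Fintype.card_fin] at h
  have hup := tendsto_integral_sum_compExp.add herr
  rw [mul_zero, add_zero] at hup
  have hev : ∀ᶠ n : ℕ in atTop, 1 ≤ n ∧ 0 < β n := by
    filter_upwards [hβ.eventually_gt_atTop 0, eventually_ge_atTop 1] with n hn hn1
    refine ⟨hn1, (hβ0 n).lt_of_ne fun h => ?_⟩
    rw [← h, zero_div] at hn
    exact lt_irrefl _ hn
  refine tendsto_of_tendsto_of_tendsto_of_le_of_le' tendsto_integral_sum_compExp hup ?_ ?_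
  · filter_upwards [hev] with n hn
    rw [← hmean]
    exact (expLengthK_bounds n hn.1 hn.2).1
  · filter_upwards [hev] with n hn
    rw [← hmean]
    exact (expLengthK_bounds n hn.1 hn.2).2

end WSTPaper
end
end
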